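/- arXiv:1805.01720 — 3 statements merged into one kernel-verified Lean document; each statement's English description precedes it below -/
import Mathlib

section
/- Let h : ℝ^d → ℝ be α-Hölder for some α ∈ (0,1], let Z ~ N(0, I_d), h̄ = h − E h(Z), and for t ∈ (0,1), x ∈ ℝ^d set Z_{x,t} = √t x + √(1−t) Z. Then for every multi-index i ∈ ℕ^d with |i| ≥ 1 and every t ∈ (0,1), x ∈ ℝ^d: |E[ H_i(Z) h̄(Z_{x,t}) ]| ≤ [h]_α E[ |H_i(Z)| |Z|^α ] (1−t)^{α/2}. -/
open MeasureTheory ProbabilityTheory Real Filter Set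

noncomputable section

/-- The standard Gaussian measure `N(0, I_d)` on `ℝ^d` (as `EuclideanSpace ℝ (Fin d)`). -/
def stdGaussian (d : ℕ) : Measure (EuclideanSpace ℝ (Fin d)) :=
  (Measure.pi fun _ : Fin d => gaussianReal 0 1).map
    ⇑(EuclideanSpace.equiv (Fin d) ℝ).symm

/-- Partial derivative in the `j`-th coordinate direction. -/
def pderivI {d : ℕ} (j : Fin d) (f : EuclideanSpace ℝ (Fin d) → ℝ) :
    EuclideanSpace ℝ (Fin d) → ℝ :=
  fun x => fderiv ℝ f x (EuclideanSpace.single j 1)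

/-- Iterated partial derivative along a list of coordinate directions (head applied last,
i.e. outermost). -/
def pderivList {d : ℕ} : List (Fin d) → (EuclideanSpace ℝ (Fin d) → ℝ) →
    EuclideanSpace ℝ (Fin d) → ℝ
  | [], f => f
  | j :: l, f => pderivI j (pderivList l f)

/-- Multi-index partial derivative `∂^{|m|}/(∂x₁^{m₁} ⋯ ∂x_d^{m_d})`. -/
def pderivMulti {d : ℕ} (m : Fin d → ℕ) (f : EuclideanSpace ℝ (Fin d) → ℝ) :
    EuclideanSpace ℝ (Fin d) → ℝ :=
  pderivList ((List.finRange d).flatMap fun j => List.replicate (m j) j) f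

/-- Multivariate Hermite polynomial
`H_m(x) = (-1)^{|m|} e^{|x|²/2} ∂^{|m|}/(∂x₁^{m₁} ⋯ ∂x_d^{m_d}) e^{-|x|²/2}`. -/
def hermiteMulti {d : ℕ} (m : Fin d → ℕ) (x : EuclideanSpace ℝ (Fin d)) : ℝ :=
  (-1 : ℝ) ^ (∑ j, m j) * Real.exp (‖x‖ ^ 2 / 2) *
    pderivMulti m (fun y => Real.exp (-‖y‖ ^ 2 / 2)) x

/-- `h̄ = h - E h(Z)` with `Z ~ N(0, I_d)`. -/
def hbar (d : ℕ) (h : EuclideanSpace ℝ (Fin d) → ℝ) (x : EuclideanSpace ℝ (Fin d)) : ℝ :=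
  h x - ∫ z, h z ∂(stdGaussian d)

/-- Barbour's solution `f_h(x) = -∫₀¹ (1/(2t)) E[ h̄(√t x + √(1-t) Z) ] dt` of the
multivariate Stein equation. -/
def steinSol (d : ℕ) (h : EuclideanSpace ℝ (Fin d) → ℝ) (x : EuclideanSpace ℝ (Fin d)) : ℝ :=
  -∫ t in Ioo (0 : ℝ) 1,
      (1 / (2 * t)) *
        ∫ z, hbar d h (Real.sqrt t • x + Real.sqrt (1 - t) • z) ∂(stdGaussian d)

/-- Entry `(i, j)` of the Hessian matrix of `f` at `x`. -/
def hessEntry {d : ℕ} (f : EuclideanSpace ℝ (Fin d) → ℝ) (x : EuclideanSpace ℝ (Fin d))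
    (i j : Fin d) : ℝ :=
  pderivI i (pderivI j f) x

/-- The Hessian matrix `∇² f(x)`. -/
def hessMatrix {d : ℕ} (f : EuclideanSpace ℝ (Fin d) → ℝ) (x : EuclideanSpace ℝ (Fin d)) :
    Matrix (Fin d) (Fin d) ℝ :=
  Matrix.of fun i j => hessEntry f x i j

/-- Operator norm `‖M‖_op = sup_{|v| = 1} |M v|` (Euclidean norms) of a `d × d` matrix. -/
def matOpNorm {d : ℕ} (M : Matrix (Fin d) (Fin d) ℝ) : ℝ :=
  sSup { r | ∃ v : EuclideanSpace ℝ (Fin d), ‖v‖ = 1 ∧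
    r = ‖(WithLp.equiv 2 (Fin d → ℝ)).symm (M.mulVec ((WithLp.equiv 2 (Fin d → ℝ)) v))‖ }

/-- The Laplacian `Δ f(x) = ∑ i ∂²f/∂x_i²(x)`. -/
def laplacian {d : ℕ} (f : EuclideanSpace ℝ (Fin d) → ℝ) (x : EuclideanSpace ℝ (Fin d)) : ℝ :=
  ∑ i, hessEntry f x i i

/-- `C` is an `α`-Hölder constant for `h`. -/
def HolderConst {d : ℕ} (α C : ℝ) (h : EuclideanSpace ℝ (Fin d) → ℝ) : Prop :=
  ∀ x y, |h x - h y| ≤ C * dist x y ^ α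

/-- The 1-Wasserstein distance in dual form: sup over 1-Lipschitz test functions. -/
def wasserstein1 {d : ℕ} (μ ν : Measure (EuclideanSpace ℝ (Fin d))) : ℝ :=
  sSup { r | ∃ h : EuclideanSpace ℝ (Fin d) → ℝ, LipschitzWith 1 h ∧
    r = (∫ x, h x ∂μ) - ∫ x, h x ∂ν }

/-- The `α`-Wasserstein distance: sup over continuous `h` with `[h]_α ≤ 1`. -/
def wassersteinHolder {d : ℕ} (α : ℝ) (μ ν : Measure (EuclideanSpace ℝ (Fin d))) : ℝ :=
  sSup { r | ∃ h : EuclideanSpace ℝ (Fin d) → ℝ, Continuous h ∧ HolderConst α 1 h ∧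
    r = (∫ x, h x ∂μ) - ∫ x, h x ∂ν }

/-- The constant `C₁(α, d)`. -/
def C1 (α : ℝ) (d : ℕ) : ℝ :=
  2 ^ (α / 2 + 1) * ((α + 2 * d) / (α * d)) * Real.Gamma ((α + d) / 2) / Real.Gamma (d / 2)

/-- The constant `C₂(α, d)`. -/
def C2 (α : ℝ) (d : ℕ) : ℝ :=
  if α = 1 then 2 * Real.sqrt (2 / π) * Real.sqrt d
  else 2 ^ (α / 2 + 1) * (α + 2 * d) * Real.Gamma ((α + d) / 2) / (α * Real.Gamma (d / 2))

end
open Polynomial in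
/-- Polynomials are integrable with respect to every real Gaussian measure. -/
lemma integrable_aeval_gaussianReal (p : ℤ[X]) (μ : ℝ) (v : NNReal) :
    Integrable (fun x : ℝ => aeval x p) (gaussianReal μ v) := by
  simp_rw [aeval_eq_sum_range]
  refine integrable_finsetSum _ fun n _ => Integrable.fun_smul _ ?_
  refine (integrable_norm_iff (by fun_prop)).mp ?_
  simpa using (memLp_id_gaussianReal (μ := μ) (v := v) n).integrable_norm_pow'

open Polynomial in
lemma integrable_gaussianPDFReal_mul_aeval (p : ℤ[X]) :
    Integrable (fun x : ℝ => gaussianPDFReal 0 1 x * aeval x p) := by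
  have h := integrable_aeval_gaussianReal p 0 1
  rw [gaussianReal_of_var_ne_zero _ one_ne_zero, integrable_withDensity_iff_integrable_smul'
    (measurable_gaussianPDF 0 1) (ae_of_all _ fun _ => gaussianPDF_lt_top)] at h
  simpa [toReal_gaussianPDF] using h

open Polynomial in
lemma hasDerivAt_neg_gaussianPDFReal_mul_hermite (n : ℕ) (x : ℝ) :
    HasDerivAt (fun y : ℝ => -(gaussianPDFReal 0 1 y * aeval y (hermite n)))
      (gaussianPDFReal 0 1 x * aeval x (hermite (n + 1))) x := by
  have h1 : HasDerivAt (fun y : ℝ => gaussianPDFReal 0 1 y) (gaussianPDFReal 0 1 x * -x) x := by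
    have h2 : HasDerivAt (fun y : ℝ => -(y - 0) ^ 2 / (2 * ((1 : NNReal) : ℝ))) (-x) x := by
      have h3 := (((hasDerivAt_id x).sub_const 0).pow 2).neg.div_const
        (2 * ((1 : NNReal) : ℝ))
      refine h3.congr_deriv ?_
      simp only [id_eq, NNReal.coe_one]
      ring
    refine (h2.exp.const_mul (√(2 * π * ((1 : NNReal) : ℝ)))⁻¹).congr_deriv ?_
    simp only [gaussianPDFReal]
    ring
  refine (h1.mul ((hermite n).hasDerivAt_aeval x)).neg.congr_deriv ?_
  simp only [hermite_succ, map_sub, map_mul, aeval_X]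
  ring

open Polynomial in
/-- Hermite polynomials of positive degree have mean zero under the standard Gaussian. -/
lemma integral_hermite_gaussianReal {n : ℕ} (hn : n ≠ 0) :
    ∫ x : ℝ, aeval x (hermite n) ∂(gaussianReal 0 1) = 0 := by
  obtain ⟨k, rfl⟩ := Nat.exists_eq_succ_of_ne_zero hn
  rw [integral_gaussianReal_eq_integral_smul one_ne_zero]
  exact integral_eq_zero_of_hasDerivAt_of_integrable
    (hasDerivAt_neg_gaussianPDFReal_mul_hermite k)
    (integrable_gaussianPDFReal_mul_aeval _) (integrable_gaussianPDFReal_mul_aeval _).neg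

lemma hasDerivAt_iterate_deriv_gaussian (n : ℕ) (x : ℝ) :
    HasDerivAt (deriv^[n] fun y : ℝ => Real.exp (-(y ^ 2 / 2)))
      (deriv^[n + 1] (fun y : ℝ => Real.exp (-(y ^ 2 / 2))) x) x := by
  rw [Function.iterate_succ_apply']
  refine DifferentiableAt.hasDerivAt ?_
  rw [funext (Polynomial.deriv_gaussian_eq_hermite_mul_gaussian n)]
  have := (Polynomial.hermite n).differentiable_aeval (𝕜 := ℝ) x
  fun_prop

lemma pderivI_prod_eq {d : ℕ} (g : ℕ → ℝ → ℝ)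
    (hg : ∀ n x, HasDerivAt (g n) (g (n + 1) x) x) (a : Fin d → ℕ) (j : Fin d) :
    pderivI j (fun y : EuclideanSpace ℝ (Fin d) => ∏ k, g (a k) (y k)) =
      fun y => ∏ k, g ((a + Pi.single j 1 : Fin d → ℕ) k) (y k) := by
  funext x
  have hk : ∀ k ∈ Finset.univ, HasFDerivAt (fun y : EuclideanSpace ℝ (Fin d) => g (a k) (y k))
      (g (a k + 1) (x k) • (EuclideanSpace.proj k : EuclideanSpace ℝ (Fin d) →L[ℝ] ℝ)) x :=
    fun k _ => (hg (a k) (x k)).comp_hasFDerivAt x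
      (EuclideanSpace.proj k : EuclideanSpace ℝ (Fin d) →L[ℝ] ℝ).hasFDerivAt
  rw [pderivI, (HasFDerivAt.finsetProd hk).fderiv]
  simp only [sum_apply, smul_apply, PiLp.proj_apply, PiLp.single_apply, smul_eq_mul]
  rw [Finset.sum_eq_single j (fun k _ hkj => by simp [hkj]) (by simp),
    ← Finset.prod_erase_mul _ _ (Finset.mem_univ j)]
  simp only [if_true, mul_one, Pi.add_apply, Pi.single_eq_same]
  congr 1
  refine Finset.prod_congr rfl fun k hk => ?_
  simp [Finset.ne_of_mem_erase hk]

lemma pderivList_prod_eq {d : ℕ} (g : ℕ → ℝ → ℝ)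
    (hg : ∀ n x, HasDerivAt (g n) (g (n + 1) x) x) (l : List (Fin d)) :
    pderivList l (fun y : EuclideanSpace ℝ (Fin d) => ∏ k, g 0 (y k)) =
      fun y => ∏ k, g (l.count k) (y k) := by
  induction l with
  | nil => simp [pderivList]
  | cons j l ih =>
    rw [pderivList, ih, pderivI_prod_eq g hg (fun k => l.count k)]
    funext y
    refine Finset.prod_congr rfl fun k _ => ?_
    congr 1
    simp [List.count_cons, Pi.single_apply, eq_comm (a := k)]

lemma count_flatMap_replicate_finRange {d : ℕ} (m : Fin d → ℕ) (k : Fin d) :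
    ((List.finRange d).flatMap fun j => List.replicate (m j) j).count k = m k := by
  rw [List.count_flatMap]
  simp only [Function.comp_def, List.count_replicate, beq_iff_eq]
  rw [← Fin.sum_univ_def]
  simp

/-- The multivariate Hermite polynomial is a product of univariate ones. -/
lemma hermiteMulti_eq_prod {d : ℕ} (m : Fin d → ℕ) (x : EuclideanSpace ℝ (Fin d)) :
    hermiteMulti m x = ∏ j, Polynomial.aeval (x j) (Polynomial.hermite (m j)) := by
  have hnorm : ∀ y : EuclideanSpace ℝ (Fin d),
      Real.exp (-‖y‖ ^ 2 / 2) = ∏ j, Real.exp (-(y j ^ 2 / 2)) := fun y => by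
    rw [← Real.exp_sum, EuclideanSpace.real_norm_sq_eq, Finset.sum_neg_distrib,
      ← Finset.sum_div, neg_div]
  have hder := pderivList_prod_eq (fun n => deriv^[n] fun y : ℝ => Real.exp (-(y ^ 2 / 2)))
    hasDerivAt_iterate_deriv_gaussian ((List.finRange d).flatMap fun j => List.replicate (m j) j)
  simp only [count_flatMap_replicate_finRange,
    Polynomial.deriv_gaussian_eq_hermite_mul_gaussian, pow_zero, Polynomial.hermite_zero,
    map_one, one_mul] at hder
  have hexp : Real.exp (‖x‖ ^ 2 / 2) * Real.exp (-‖x‖ ^ 2 / 2) = 1 := by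
    rw [← Real.exp_add, ← Real.exp_zero]
    ring_nf
  have hsign : (-1 : ℝ) ^ (∑ j, m j) * (-1 : ℝ) ^ (∑ j, m j) = 1 := by
    rw [← mul_pow]
    simp
  rw [hermiteMulti, pderivMulti, funext hnorm, hder]
  simp only [Finset.prod_mul_distrib, Finset.prod_pow_eq_pow_sum]
  rw [← hnorm]
  linear_combination (∏ j, Polynomial.aeval (x j) (Polynomial.hermite (m j))) *
    (hsign * (Real.exp (‖x‖ ^ 2 / 2) * Real.exp (-‖x‖ ^ 2 / 2)) + hexp)

lemma continuous_hermiteMulti {d : ℕ} (m : Fin d → ℕ) : Continuous (hermiteMulti m) := by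
  rw [funext (hermiteMulti_eq_prod m)]
  refine continuous_finsetProd _ fun j _ => ?_
  exact (Polynomial.hermite (m j)).continuous_aeval.comp (by fun_prop)

lemma integrable_stdGaussian_iff {d : ℕ} {f : EuclideanSpace ℝ (Fin d) → ℝ} :
    Integrable f (stdGaussian d) ↔
      Integrable (fun y => f ((EuclideanSpace.equiv (Fin d) ℝ).symm y))
        (Measure.pi fun _ : Fin d => gaussianReal 0 1) :=
  (EuclideanSpace.equiv (Fin d) ℝ).symm.toHomeomorph.measurableEmbedding.integrable_map_iff

lemma integral_stdGaussian {d : ℕ} (f : EuclideanSpace ℝ (Fin d) → ℝ) :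
    ∫ z, f z ∂(stdGaussian d) = ∫ y, f ((EuclideanSpace.equiv (Fin d) ℝ).symm y)
        ∂(Measure.pi fun _ : Fin d => gaussianReal 0 1) :=
  (EuclideanSpace.equiv (Fin d) ℝ).symm.toHomeomorph.measurableEmbedding.integral_map f

instance isProbabilityMeasure_stdGaussian_euclidean (d : ℕ) :
    IsProbabilityMeasure (stdGaussian d) :=
  Measure.isProbabilityMeasure_map (by fun_prop)

lemma memLp_two_hermiteMulti {d : ℕ} (m : Fin d → ℕ) :
    MemLp (hermiteMulti m) 2 (stdGaussian d) := by
  rw [memLp_two_iff_integrable_sq (continuous_hermiteMulti m).aestronglyMeasurable,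
    integrable_stdGaussian_iff]
  simp only [hermiteMulti_eq_prod, ← Finset.prod_pow, ← map_pow]
  exact Integrable.fintype_prod
    (f := fun j x => Polynomial.aeval x (Polynomial.hermite (m j) ^ 2))
    fun j => integrable_aeval_gaussianReal _ 0 1

lemma memLp_two_norm_stdGaussian (d : ℕ) :
    MemLp (fun z : EuclideanSpace ℝ (Fin d) => ‖z‖) 2 (stdGaussian d) := by
  rw [memLp_two_iff_integrable_sq (by fun_prop), integrable_stdGaussian_iff]
  simp only [EuclideanSpace.real_norm_sq_eq]
  refine integrable_finsetSum _ fun j _ => ?_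
  have h := (integrable_aeval_gaussianReal (Polynomial.X ^ 2) 0 1)
  simp only [map_pow, Polynomial.aeval_X] at h
  exact integrable_comp_eval (μ := fun _ : Fin d => gaussianReal 0 1) (i := j) h

lemma memLp_two_norm_rpow_stdGaussian (d : ℕ) {α : ℝ} (hα : α ∈ Set.Ioc (0 : ℝ) 1) :
    MemLp (fun z : EuclideanSpace ℝ (Fin d) => ‖z‖ ^ α) 2 (stdGaussian d) := by
  refine MemLp.mono ((memLp_const (1 : ℝ)).add (memLp_two_norm_stdGaussian d))
    (continuous_norm.rpow_const fun _ => .inr hα.1.le).aestronglyMeasurable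
    (ae_of_all _ fun z => ?_)
  have hz := norm_nonneg z
  rw [Real.norm_of_nonneg (by positivity),
    Real.norm_of_nonneg (by simp only [Pi.add_apply]; positivity)]
  simp only [Pi.add_apply]
  rcases le_total ‖z‖ 1 with h | h
  · linarith [Real.rpow_le_one hz h hα.1.le]
  · have := Real.rpow_le_rpow_of_exponent_le h hα.2
    rw [Real.rpow_one] at this
    linarith

lemma integral_hermiteMulti_eq_zero {d : ℕ} {m : Fin d → ℕ} (hm : 1 ≤ ∑ j, m j) :
    ∫ z, hermiteMulti m z ∂(stdGaussian d) = 0 := by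
  obtain ⟨j, hj⟩ : ∃ j, m j ≠ 0 := by
    by_contra! h
    simp [h] at hm
  simp only [integral_stdGaussian, hermiteMulti_eq_prod]
  refine (integral_fintype_prod_eq_prod
    (fun j (x : ℝ) => Polynomial.aeval x (Polynomial.hermite (m j)))).trans ?_
  exact Finset.prod_eq_zero (Finset.mem_univ j) (integral_hermite_gaussianReal hj)

lemma HolderConst.continuous {d : ℕ} {α C : ℝ} {h : EuclideanSpace ℝ (Fin d) → ℝ}
    (hC : HolderConst α C h) (hα : 0 < α) : Continuous h := by
  refine continuous_iff_continuousAt.mpr fun y => tendsto_iff_dist_tendsto_zero.mpr ?_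
  refine squeeze_zero (fun _ => dist_nonneg) (fun x => hC x y) ?_
  have : Continuous fun x => C * dist x y ^ α :=
    continuous_const.mul ((continuous_id.dist continuous_const).rpow_const fun _ => .inr hα.le)
  simpa [hα.ne'] using this.tendsto y

/-- **Display (2.5)**: the key bound
`|E[H_i(Z) h̄(Z_{x,t})]| ≤ [h]_α E[|H_i(Z)| |Z|^α] (1-t)^{α/2}` for `α`-Hölder `h`. -/
theorem abs_integral_hermite_mul_hbar_le
    {d : ℕ} (hd : 1 ≤ d) {α : ℝ} (hα : α ∈ Set.Ioc (0 : ℝ) 1)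
    (h : EuclideanSpace ℝ (Fin d) → ℝ)
    {C : ℝ} (hC0 : 0 ≤ C) (hC : HolderConst α C h)
    (m : Fin d → ℕ) (hm : 1 ≤ ∑ j, m j)
    (t : ℝ) (ht : t ∈ Set.Ioo (0 : ℝ) 1) (x : EuclideanSpace ℝ (Fin d)) :
    |∫ z, hermiteMulti m z *
        hbar d h (Real.sqrt t • x + Real.sqrt (1 - t) • z) ∂(stdGaussian d)| ≤
      C * (∫ z, |hermiteMulti m z| * ‖z‖ ^ α ∂(stdGaussian d)) * (1 - t) ^ (α / 2) := by
  set s := Real.sqrt (1 - t)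
  set D : EuclideanSpace ℝ (Fin d) → ℝ :=
    fun z => h (Real.sqrt t • x + s • z) - h (Real.sqrt t • x) with hD
  set K := (1 - t) ^ (α / 2)
  have hH : Integrable (hermiteMulti m) (stdGaussian d) :=
    (memLp_two_hermiteMulti m).integrable (by norm_num)
  have hHn : Integrable (fun z => |hermiteMulti m z| * ‖z‖ ^ α) (stdGaussian d) :=
    (memLp_two_hermiteMulti m).abs.integrable_mul (memLp_two_norm_rpow_stdGaussian d hα)
  have hDle : ∀ z, ‖hermiteMulti m z * D z‖ ≤ C * K * (|hermiteMulti m z| * ‖z‖ ^ α) := fun z => by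
    have h1 := hC (Real.sqrt t • x + s • z) (Real.sqrt t • x)
    have h2 : s ^ α = K := by
      rw [show s = (1 - t) ^ (1 / 2 : ℝ) from Real.sqrt_eq_rpow _, ← Real.rpow_mul (by linarith [ht.2])]
      change _ = (1 - t) ^ (α / 2)
      congr 1
      ring
    rw [dist_eq_norm, add_sub_cancel_left, norm_smul, Real.norm_of_nonneg (Real.sqrt_nonneg _),
      Real.mul_rpow (Real.sqrt_nonneg _) (norm_nonneg _), h2] at h1
    rw [norm_mul, Real.norm_eq_abs, Real.norm_eq_abs]
    linarith [mul_le_mul_of_nonneg_left h1 (abs_nonneg (hermiteMulti m z))]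
  have hcont := hC.continuous hα.1
  have hHD : Integrable (fun z => hermiteMulti m z * D z) (stdGaussian d) :=
    (hHn.const_mul (C * K)).mono'
      ((continuous_hermiteMulti m).mul (by fun_prop)).aestronglyMeasurable (ae_of_all _ hDle)
  have hsplit : ∀ z, hermiteMulti m z * hbar d h (Real.sqrt t • x + s • z) =
      hermiteMulti m z * D z + hermiteMulti m z * hbar d h (Real.sqrt t • x) := fun z => by
    simp only [hD, hbar]
    ring
  simp_rw [hsplit]
  rw [integral_add hHD (hH.mul_const _), integral_mul_const, integral_hermiteMulti_eq_zero hm,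
    zero_mul, add_zero]
  refine (norm_integral_le_of_norm_le (hHn.const_mul (C * K)) (ae_of_all _ hDle)).trans_eq ?_
  rw [integral_const_mul]
  ring
end

section
/- Let h : ℝ^d → ℝ be α-Hölder for some α ∈ (0,1], and let f_h(x) = −∫₀¹ (1/(2t)) E[ h̄(√t x + √(1−t) Z) ] dt with h̄ = h − E h(Z), Z ~ N(0, I_d). Then the Hessian of f_h is uniformly bounded in operator norm: for all x ∈ ℝ^d, ‖∇²f_h(x)‖_op ≤ 2^{α/2} ((α+2d)/(αd)) Γ((α+d)/2)/Γ(d/2) · [h]_α. -/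
open MeasureTheory ProbabilityTheory Real Filter Set

open scoped RealInnerProductSpace

lemma norm_smul_innerSL_le {E : Type*} [NormedAddCommGroup E] [InnerProductSpace ℝ E]
    (a : ℝ) (z : E) : ‖a • innerSL ℝ z‖ ≤ |a| * (1 + ‖z‖) := by
  rw [norm_smul, innerSL_apply_norm, Real.norm_eq_abs]
  gcongr
  linarith

lemma abs_add_le_exp_bound {E : Type*} [NormedAddCommGroup E] {g : E → ℝ} {A c : ℝ} (hc : 0 ≤ c)
    (hA : ∀ z, |g z| ≤ A * Real.exp (c * ‖z‖)) (m : E) :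
    ∀ z, |g (m + z)| ≤ (A * Real.exp (c * ‖m‖)) * Real.exp (c * ‖z‖) := by
  have hA0 : 0 ≤ A := by simpa using (abs_nonneg _).trans (hA 0)
  intro z
  refine (hA _).trans ?_
  rw [mul_assoc, ← Real.exp_add, ← mul_add]
  gcongr
  exact norm_add_le _ _

lemma sq_inner_le_one_add_norm {E : Type*} [NormedAddCommGroup E] [InnerProductSpace ℝ E]
    (v z : E) : |⟪v, z⟫ ^ 2| ≤ ‖v‖ ^ 2 * (1 + ‖z‖) ^ 2 := by
  rw [abs_pow, ← mul_pow]
  gcongr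
  exact (abs_real_inner_le_norm v z).trans (by gcongr; linarith)

lemma norm_inner_smul_innerSL_sub_le {E : Type*} [NormedAddCommGroup E] [InnerProductSpace ℝ E]
    (v z : E) :
    ‖⟪v, z⟫ • innerSL ℝ z - innerSL ℝ v‖ ≤ (2 * ‖v‖) * (1 + ‖z‖) ^ 2 := by
  refine (norm_sub_le _ _).trans ?_
  rw [norm_smul, innerSL_apply_norm, innerSL_apply_norm]
  have h1 : ‖⟪v, z⟫‖ * ‖z‖ ≤ ‖v‖ * ‖z‖ * ‖z‖ := by gcongr; exact norm_inner_le_norm v z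
  nlinarith [norm_nonneg v, mul_nonneg (norm_nonneg v) (norm_nonneg z),
    mul_nonneg (mul_nonneg (norm_nonneg v) (norm_nonneg z)) (norm_nonneg z)]

section Gaussian

variable {E : Type*} [NormedAddCommGroup E] [InnerProductSpace ℝ E] [FiniteDimensional ℝ E]
  [MeasurableSpace E] [BorelSpace E]

variable (E) in
/-- The standard Gaussian has density `(2π)^{-n/2} exp(-|x|²/2)` with respect to Lebesgue measure. -/
lemma stdGaussian_eq_withDensity :
    ProbabilityTheory.stdGaussian E = (volume : Measure E).withDensity fun x =>
      ENNReal.ofReal ((2 * π) ^ (-(Module.finrank ℝ E : ℝ) / 2) * Real.exp (-‖x‖ ^ 2 / 2)) := by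
  have h_int : Integrable (fun x : E => (2 * π) ^ (-(Module.finrank ℝ E : ℝ) / 2) *
      Real.exp (-‖x‖ ^ 2 / 2)) := by
    have := (GaussianFourier.integrable_cexp_neg_mul_sq_norm_add (V := E) (b := 1 / 2)
      (by norm_num) 0 0).re
    refine (this.congr (Eventually.of_forall fun x => ?_)).const_mul _
    have : (-(1 / 2 : ℂ) * (‖x‖ : ℂ) ^ 2 + 0 * ((inner ℝ (0 : E) x : ℝ) : ℂ))
        = ((-‖x‖ ^ 2 / 2 : ℝ) : ℂ) := by
      push_cast; ring
    simp only [this, ← Complex.ofReal_exp]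
    rfl
  have := isFiniteMeasure_withDensity_ofReal h_int.2
  apply Measure.ext_of_charFun
  ext t
  have key := GaussianFourier.integral_cexp_neg_mul_sq_norm_add (V := E) (b := 1 / 2)
      (by norm_num) Complex.I t
  rw [charFun_stdGaussian, charFun_apply, integral_withDensity_eq_integral_toReal_smul
    (by fun_prop) (by simp)]
  have hpi : (0 : ℝ) < 2 * π := by positivity
  have h2 : ∀ x : E, (ENNReal.ofReal ((2 * π) ^ (-(Module.finrank ℝ E : ℝ) / 2) *
      Real.exp (-‖x‖ ^ 2 / 2))).toReal • Complex.exp (((inner ℝ x t : ℝ) : ℂ) * Complex.I)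
      = (((2 * π) ^ (-(Module.finrank ℝ E : ℝ) / 2) : ℝ) : ℂ) *
        Complex.exp (-(1 / 2 : ℂ) * (‖x‖ : ℂ) ^ 2 + Complex.I * ((inner ℝ t x : ℝ) : ℂ)) := by
    intro x
    rw [ENNReal.toReal_ofReal (by positivity), Complex.exp_add, Complex.real_smul]
    have : (-(1 / 2 : ℂ) * (‖x‖ : ℂ) ^ 2) = ((-‖x‖ ^ 2 / 2 : ℝ) : ℂ) := by
      push_cast; ring
    rw [this, ← Complex.ofReal_exp, real_inner_comm, mul_comm Complex.I]
    push_cast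
    ring
  simp_rw [h2]
  rw [integral_const_mul, key, ← mul_assoc]
  have h3 : (π / (1 / 2) : ℂ) = ((2 * π : ℝ) : ℂ) := by push_cast; ring
  have h4 : ((Module.finrank ℝ E : ℂ) / 2) = (((Module.finrank ℝ E : ℝ) / 2 : ℝ) : ℂ) := by
    push_cast; ring
  rw [h3, h4, ← Complex.ofReal_cpow hpi.le, ← Complex.ofReal_mul, ← rpow_add hpi, neg_div (2 : ℝ),
    neg_add_cancel, rpow_zero, Complex.I_sq]
  push_cast
  ring_nf

lemma integral_stdGaussian_s15 {F : Type*} [NormedAddCommGroup F] [NormedSpace ℝ F] (f : E → F) :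
    ∫ z, f z ∂(ProbabilityTheory.stdGaussian E) =
      ∫ z, ((2 * π) ^ (-(Module.finrank ℝ E : ℝ) / 2) * Real.exp (-‖z‖ ^ 2 / 2)) • f z := by
  rw [stdGaussian_eq_withDensity, integral_withDensity_eq_integral_toReal_smul
    (by fun_prop) (by simp)]
  congr with z
  rw [ENNReal.toReal_ofReal (by positivity)]

/-- The Cameron–Martin formula for the standard Gaussian. -/
lemma integral_stdGaussian_add {F : Type*} [NormedAddCommGroup F] [NormedSpace ℝ F]
    (g : E → F) (m : E) :
    ∫ z, g (m + z) ∂(ProbabilityTheory.stdGaussian E) =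
      ∫ z, Real.exp (⟪m, z⟫ - ‖m‖ ^ 2 / 2) • g z ∂(ProbabilityTheory.stdGaussian E) := by
  rw [integral_stdGaussian_s15, integral_stdGaussian_s15]
  symm
  rw [← integral_add_left_eq_self _ m]
  congr with z
  rw [smul_smul, mul_assoc, ← Real.exp_add]
  congr 3
  rw [norm_add_sq_real, inner_add_right, real_inner_self_eq_norm_sq]
  ring

lemma integrable_exp_mul_norm_stdGaussian (c : ℝ) :
    Integrable (fun z => Real.exp (c * ‖z‖)) (ProbabilityTheory.stdGaussian E) := by
  obtain ⟨C, hC, h_int⟩ := IsGaussian.exists_integrable_exp_sq (ProbabilityTheory.stdGaussian E)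
  refine (h_int.const_mul (Real.exp (c ^ 2 / (4 * C)))).mono' (by fun_prop)
    (Eventually.of_forall fun z => ?_)
  rw [Real.norm_eq_abs, abs_of_pos (Real.exp_pos _), ← Real.exp_add]
  gcongr
  have : c ^ 2 / (4 * C) + C * ‖z‖ ^ 2 - c * ‖z‖ = (c - 2 * C * ‖z‖) ^ 2 / (4 * C) := by
    field_simp; ring
  have : 0 ≤ (c - 2 * C * ‖z‖) ^ 2 / (4 * C) := by positivity
  linarith

lemma integrable_of_norm_le_exp {F : Type*} [NormedAddCommGroup F] {f : E → F}
    (hf : Continuous f) {A c : ℝ} (hle : ∀ z, ‖f z‖ ≤ A * Real.exp (c * ‖z‖)) :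
    Integrable f (ProbabilityTheory.stdGaussian E) :=
  ((integrable_exp_mul_norm_stdGaussian c).const_mul A).mono'
    hf.aestronglyMeasurable (Eventually.of_forall hle)

lemma integrable_of_norm_le_norm_mul_exp {F : Type*} [NormedAddCommGroup F] {f : E → F}
    (hf : Continuous f) {A c : ℝ} (hA : 0 ≤ A) (n : ℕ)
    (hle : ∀ z, ‖f z‖ ≤ A * Real.exp (c * ‖z‖) * (1 + ‖z‖) ^ n) :
    Integrable f (ProbabilityTheory.stdGaussian E) := by
  refine integrable_of_norm_le_exp hf (A := A) (c := c + n) fun z => (hle z).trans ?_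
  rw [mul_assoc, add_mul, Real.exp_add, Real.exp_nat_mul]
  gcongr
  linarith [Real.add_one_le_exp ‖z‖]

/-- Differentiation of the translates of a function of exponential growth under a Gaussian mean. -/
lemma hasFDerivAt_integral_stdGaussian_add {g : E → ℝ} (hg : Continuous g) {A c : ℝ}
    (hA : ∀ z, |g z| ≤ A * Real.exp (c * ‖z‖)) (m : E) :
    HasFDerivAt (fun m => ∫ z, g (m + z) ∂(ProbabilityTheory.stdGaussian E))
      (∫ z, g (m + z) • innerSL ℝ z ∂(ProbabilityTheory.stdGaussian E)) m := by
  have hA0 : 0 ≤ A := by simpa using (abs_nonneg _).trans (hA 0)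
  have hL : ∫ z, g (m + z) • innerSL ℝ z ∂(ProbabilityTheory.stdGaussian E) =
      ∫ z, (Real.exp (⟪m, z⟫ - ‖m‖ ^ 2 / 2) * g z) • (innerSL ℝ z - innerSL ℝ m)
        ∂(ProbabilityTheory.stdGaussian E) := by
    have := integral_stdGaussian_add (fun y => g y • innerSL ℝ (y - m)) m
    simp only [add_sub_cancel_left, map_sub] at this
    simp_rw [this, smul_smul]
  rw [hL]
  simp_rw [integral_stdGaussian_add g, smul_eq_mul]
  have hexp : ∀ x ∈ Metric.ball m 1, ∀ z : E, |Real.exp (⟪x, z⟫ - ‖x‖ ^ 2 / 2) * g z| ≤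
      A * Real.exp ((c + (‖m‖ + 1)) * ‖z‖) := by
    intro x hx z
    have hxn : ‖x‖ ≤ ‖m‖ + 1 := by
      have h1 := norm_le_norm_add_norm_sub' x m
      have h2 := mem_ball_iff_norm.1 hx
      linarith
    have h3 : ⟪x, z⟫ ≤ (‖m‖ + 1) * ‖z‖ := (real_inner_le_norm x z).trans (by gcongr)
    rw [abs_mul, abs_of_pos (Real.exp_pos _), add_mul, Real.exp_add, mul_comm, ← mul_assoc]
    gcongr
    · exact hA z
    · have : 0 ≤ ‖x‖ ^ 2 / 2 := by positivity
      linarith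
  refine hasFDerivAt_integral_of_dominated_of_fderiv_le (s := Metric.ball m 1)
    (bound := fun z => A * Real.exp ((c + (‖m‖ + 1)) * ‖z‖) * (‖z‖ + (‖m‖ + 1)))
    (F' := fun x z => (Real.exp (⟪x, z⟫ - ‖x‖ ^ 2 / 2) * g z) • (innerSL ℝ z - innerSL ℝ x))
    (Metric.ball_mem_nhds m one_pos) (Eventually.of_forall fun x => ?_) ?_ ?_
    (Eventually.of_forall fun z x hx => ?_) ?_ (Eventually.of_forall fun z x hx => ?_)
  · exact (by fun_prop : Continuous fun z : E =>
      Real.exp (⟪x, z⟫ - ‖x‖ ^ 2 / 2) * g z).aestronglyMeasurable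
  · exact integrable_of_norm_le_exp (by fun_prop) (hexp m (Metric.mem_ball_self one_pos))
  · exact (by fun_prop : Continuous fun z : E =>
      (Real.exp (⟪m, z⟫ - ‖m‖ ^ 2 / 2) * g z) •
        (innerSL ℝ z - innerSL ℝ m)).aestronglyMeasurable
  · rw [norm_smul, Real.norm_eq_abs]
    have h2 := mem_ball_iff_norm.1 hx
    have h1 := norm_le_norm_add_norm_sub' x m
    gcongr
    · exact hexp x hx z
    · refine (norm_sub_le _ _).trans ?_
      rw [innerSL_apply_norm, innerSL_apply_norm]
      linarith
  · refine integrable_of_norm_le_norm_mul_exp (A := A * (‖m‖ + 1)) (c := c + (‖m‖ + 1))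
      (by fun_prop) (by positivity) 1 fun z => ?_
    rw [Real.norm_eq_abs, abs_of_nonneg (by positivity), pow_one]
    have : ‖z‖ + (‖m‖ + 1) ≤ (‖m‖ + 1) * (1 + ‖z‖) := by
      nlinarith [norm_nonneg m, norm_nonneg z]
    calc _ ≤ A * Real.exp ((c + (‖m‖ + 1)) * ‖z‖) * ((‖m‖ + 1) * (1 + ‖z‖)) := by gcongr
      _ = _ := by ring
  · have h1 : HasFDerivAt (fun x : E => ⟪x, z⟫ - ‖x‖ ^ 2 / 2)
        (innerSL ℝ z - innerSL ℝ x) x := by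
      have h2 : HasFDerivAt (fun x : E => ⟪x, z⟫) (innerSL ℝ z) x := by
        simp_rw [real_inner_comm z]
        exact (innerSL ℝ z).hasFDerivAt (x := x)
      have h3 := (hasStrictFDerivAt_norm_sq x).hasFDerivAt.mul_const (1 / 2 : ℝ)
      have h4 := h2.sub h3
      convert! h4 using 1
      · ext y; simp; ring
      · ext y; simp
    convert! h1.exp.mul_const (g z) using 1
    rw [smul_smul, mul_comm]

lemma hasFDerivAt_integral_stdGaussian_add_mul_inner {g : E → ℝ} (hg : Continuous g) {A c : ℝ}
    (hc : 0 ≤ c) (hA : ∀ z, |g z| ≤ A * Real.exp (c * ‖z‖)) (v m : E) :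
    HasFDerivAt (fun m => ∫ z, g (m + z) * ⟪v, z⟫ ∂(ProbabilityTheory.stdGaussian E))
      (∫ z, g (m + z) • (⟪v, z⟫ • innerSL ℝ z - innerSL ℝ v)
        ∂(ProbabilityTheory.stdGaussian E)) m := by
  have hA0 : 0 ≤ A := by simpa using (abs_nonneg _).trans (hA 0)
  have hb := abs_add_le_exp_bound hc hA
  have hv : ∀ z : E, |⟪v, z⟫| ≤ ‖v‖ * (1 + ‖z‖) := fun z =>
    (abs_real_inner_le_norm v z).trans (by gcongr; linarith)
  have i0 : ∀ m : E, Integrable (fun z => g (m + z)) (ProbabilityTheory.stdGaussian E) :=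
    fun m => integrable_of_norm_le_exp (by fun_prop) (hb m)
  have i1 : ∀ m : E, Integrable (fun z => g (m + z) * ⟪v, z⟫)
      (ProbabilityTheory.stdGaussian E) := fun m =>
    integrable_of_norm_le_norm_mul_exp (by fun_prop) (c := c)
      (A := A * Real.exp (c * ‖m‖) * ‖v‖) (by positivity) 1 fun z => by
        rw [Real.norm_eq_abs, abs_mul, pow_one]
        calc _ ≤ A * Real.exp (c * ‖m‖) * Real.exp (c * ‖z‖) * (‖v‖ * (1 + ‖z‖)) := by
              gcongr
              · exact hb m z
              · exact hv z
          _ = _ := by ring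
  have i2 : Integrable (fun z => g (m + z) • innerSL ℝ z) (ProbabilityTheory.stdGaussian E) :=
    integrable_of_norm_le_norm_mul_exp (by fun_prop) (c := c)
      (A := A * Real.exp (c * ‖m‖)) (by positivity) 1 fun z => by
        refine (norm_smul_innerSL_le _ z).trans ?_
        rw [pow_one]
        gcongr
        exact hb m z
  have i3 : Integrable (fun z => (g (m + z) * ⟪v, z⟫) • innerSL ℝ z)
      (ProbabilityTheory.stdGaussian E) :=
    integrable_of_norm_le_norm_mul_exp (by fun_prop) (c := c)
      (A := A * Real.exp (c * ‖m‖) * ‖v‖) (by positivity) 2 fun z => by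
        refine (norm_smul_innerSL_le _ z).trans ?_
        rw [abs_mul]
        calc _ ≤ A * Real.exp (c * ‖m‖) * Real.exp (c * ‖z‖) * (‖v‖ * (1 + ‖z‖)) * (1 + ‖z‖) := by
              gcongr
              · exact hb m z
              · exact hv z
          _ = _ := by ring
  have hg' : ∀ z, |g z * ⟪v, z⟫| ≤ A * ‖v‖ * Real.exp ((c + 1) * ‖z‖) := fun z => by
    rw [abs_mul, add_mul, one_mul, Real.exp_add]
    calc _ ≤ A * Real.exp (c * ‖z‖) * (‖v‖ * (1 + ‖z‖)) := by
          gcongr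
          · exact hA z
          · exact hv z
      _ ≤ A * Real.exp (c * ‖z‖) * (‖v‖ * Real.exp ‖z‖) := by
          gcongr; linarith [Real.add_one_le_exp ‖z‖]
      _ = _ := by ring
  have d1 := hasFDerivAt_integral_stdGaussian_add (g := fun z => g z * ⟪v, z⟫)
    (by fun_prop) hg' m
  have d2 := ((innerSL ℝ v).hasFDerivAt (x := m)).mul
    (hasFDerivAt_integral_stdGaussian_add hg hA m)
  convert! d1.sub d2 using 1
  · ext x
    have : ∀ z, g (x + z) * ⟪v, x + z⟫ = g (x + z) * ⟪v, z⟫ + ⟪v, x⟫ * g (x + z) := fun z => by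
      rw [inner_add_right]; ring
    simp only [Pi.sub_apply, Pi.mul_apply, innerSL_apply_apply, this]
    rw [integral_add (i1 x) ((i0 x).const_mul _), integral_const_mul]
    ring
  · have e1 : ∀ z, g (m + z) • (⟪v, z⟫ • innerSL ℝ z - innerSL ℝ v) =
        (g (m + z) * ⟪v, z⟫) • innerSL ℝ z - g (m + z) • innerSL ℝ v := fun z => by
      rw [smul_sub, smul_smul]
    have e2 : ∀ z, (g (m + z) * ⟪v, m + z⟫) • innerSL ℝ z =
        (g (m + z) * ⟪v, z⟫) • innerSL ℝ z + ⟪v, m⟫ • (g (m + z) • innerSL ℝ z) := fun z => by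
      rw [inner_add_right, smul_smul, ← add_smul]; congr 1; ring
    have i4 : Integrable (fun z => ⟪v, m⟫ • (g (m + z) • innerSL ℝ z))
        (ProbabilityTheory.stdGaussian E) := i2.smul ⟪v, m⟫
    simp_rw [e1, e2]
    rw [integral_sub i3 ((i0 m).smul_const _), integral_add i3 i4, integral_smul,
      integral_smul_const]
    simp only [innerSL_apply_apply]
    abel

/-- The absolute moments of the norm of a standard Gaussian vector. -/
lemma integral_norm_rpow_stdGaussian [Nontrivial E] {p : ℝ} (hp : 0 ≤ p) :
    ∫ z, ‖z‖ ^ p ∂(ProbabilityTheory.stdGaussian E) =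
      2 ^ (p / 2) * Real.Gamma ((p + Module.finrank ℝ E) / 2) /
        Real.Gamma (Module.finrank ℝ E / 2) := by
  have hn : 1 ≤ Module.finrank ℝ E := Module.finrank_pos
  have hn' : (1 : ℝ) ≤ Module.finrank ℝ E := by exact_mod_cast hn
  set n := Module.finrank ℝ E with hndef
  obtain ⟨K, hK⟩ : ∃ K : ℝ, ∀ q : ℝ, 0 ≤ q → ∫ z, ‖z‖ ^ q ∂(ProbabilityTheory.stdGaussian E) =
      K * (2 ^ (q / 2) * Real.Gamma ((q + n) / 2)) := by
    refine ⟨n * (volume : Measure E).real (Metric.ball 0 1) *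
      (2 * π) ^ (-(n : ℝ) / 2) * (2 ^ ((n : ℝ) / 2) * (1 / 2)), fun q hq => ?_⟩
    rw [integral_stdGaussian_s15]
    rw [integral_fun_norm_addHaar (volume : Measure E)
      (fun r => ((2 * π) ^ (-(n : ℝ) / 2) * Real.exp (-r ^ 2 / 2)) • r ^ q)]
    have h1 : ∫ y in Ioi (0 : ℝ), y ^ (n - 1) •
        ((2 * π) ^ (-(n : ℝ) / 2) * Real.exp (-y ^ 2 / 2)) • y ^ q =
        ∫ y in Ioi (0 : ℝ), (2 * π) ^ (-(n : ℝ) / 2) *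
          (y ^ (q + n - 1) * Real.exp (-(1 / 2) * y ^ (2 : ℝ))) := by
      refine setIntegral_congr_fun measurableSet_Ioi fun y hy => ?_
      have hy : 0 < y := hy
      have h2 : y ^ (q + n - 1) = y ^ (n - 1) * y ^ q := by
        rw [← rpow_natCast, ← rpow_add hy, Nat.cast_sub hn]
        congr 1
        push_cast
        ring
      have h3 : -(1 / 2) * y ^ (2 : ℝ) = -y ^ 2 / 2 := by
        rw [rpow_ofNat]; ring
      simp only [smul_eq_mul]
      rw [h2, h3]
      ring
    rw [h1, integral_const_mul, integral_rpow_mul_exp_neg_mul_rpow (by norm_num)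
      (by linarith) (by norm_num)]
    have h4 : (1 / 2 : ℝ) ^ (-(q + n - 1 + 1) / 2) = 2 ^ (q / 2) * 2 ^ ((n : ℝ) / 2) := by
      rw [← rpow_add (by norm_num), one_div, inv_rpow (by norm_num), ← rpow_neg (by norm_num)]
      congr 1
      ring
    rw [h4, ← hndef, sub_add_cancel]
    simp only [nsmul_eq_mul, smul_eq_mul]
    ring
  have h0 := hK 0 le_rfl
  simp only [rpow_zero, integral_const, probReal_univ, smul_eq_mul, mul_one, zero_div, one_mul,
    zero_add] at h0
  have hΓ : 0 < Real.Gamma ((n : ℝ) / 2) := Real.Gamma_pos_of_pos (by positivity)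
  rw [hK p hp, eq_div_iff hΓ.ne']
  linear_combination (-2 ^ (p / 2) * Real.Gamma ((p + n) / 2)) * h0

lemma integrable_norm_rpow_mul_stdGaussian {p : ℝ} (hp : 0 ≤ p) {f : E → ℝ} (hf : Continuous f)
    {A : ℝ} {n : ℕ} (hA : 0 ≤ A) (hle : ∀ z, |f z| ≤ A * (1 + ‖z‖) ^ n) :
    Integrable (fun z => ‖z‖ ^ p * f z) (ProbabilityTheory.stdGaussian E) := by
  refine integrable_of_norm_le_norm_mul_exp (A := A) (c := p)
    ((continuous_norm.rpow_const fun _ => .inr hp).mul hf) hA n fun z => ?_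
  rw [Real.norm_eq_abs, abs_mul, abs_of_nonneg (by positivity)]
  have h1 : ‖z‖ ^ p ≤ Real.exp (p * ‖z‖) := by
    rw [mul_comm, Real.exp_mul]
    gcongr
    linarith [Real.add_one_le_exp ‖z‖]
  calc _ ≤ Real.exp (p * ‖z‖) * (A * (1 + ‖z‖) ^ n) := by gcongr; exact hle z
    _ = _ := by ring

lemma integral_comp_linearIsometryEquiv_stdGaussian (e : E ≃ₗᵢ[ℝ] E) (f : E → ℝ) :
    ∫ z, f (e z) ∂(ProbabilityTheory.stdGaussian E) =
      ∫ z, f z ∂(ProbabilityTheory.stdGaussian E) := by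
  conv_rhs => rw [← stdGaussian_map e]
  exact (e.toHomeomorph.measurableEmbedding.integral_map f).symm

lemma integral_norm_rpow_mul_inner_sq_stdGaussian [Nontrivial E] {p : ℝ} (hp : 0 ≤ p) {v : E}
    (hv : ‖v‖ = 1) :
    ∫ z, ‖z‖ ^ p * ⟪v, z⟫ ^ 2 ∂(ProbabilityTheory.stdGaussian E) =
      (p + Module.finrank ℝ E) / Module.finrank ℝ E *
        ∫ z, ‖z‖ ^ p ∂(ProbabilityTheory.stdGaussian E) := by
  have hn : (0 : ℝ) < Module.finrank ℝ E := by exact_mod_cast Module.finrank_pos (R := ℝ) (M := E)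
  have hrot : ∀ w : E, ‖w‖ = 1 → ∫ z, ‖z‖ ^ p * ⟪w, z⟫ ^ 2 ∂(ProbabilityTheory.stdGaussian E) =
      ∫ z, ‖z‖ ^ p * ⟪v, z⟫ ^ 2 ∂(ProbabilityTheory.stdGaussian E) := by
    intro w hw
    obtain ⟨e, rfl⟩ : ∃ e : E ≃ₗᵢ[ℝ] E, e v = w :=
      ⟨(ℝ ∙ (v - w))ᗮ.reflection, Submodule.reflection_sub (hv.trans hw.symm)⟩
    rw [← integral_comp_linearIsometryEquiv_stdGaussian e]
    simp_rw [LinearIsometryEquiv.inner_map_map, LinearIsometryEquiv.norm_map]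
  have hsum : ∑ i, ∫ z, ‖z‖ ^ p * ⟪stdOrthonormalBasis ℝ E i, z⟫ ^ 2
      ∂(ProbabilityTheory.stdGaussian E) =
      ∫ z, ‖z‖ ^ (p + 2) ∂(ProbabilityTheory.stdGaussian E) := by
    rw [← integral_finsetSum _ fun i _ => integrable_norm_rpow_mul_stdGaussian hp (by fun_prop)
      (by positivity) (sq_inner_le_one_add_norm _)]
    congr with z
    rw [← Finset.mul_sum, (stdOrthonormalBasis ℝ E).sum_sq_inner_right,
      ← rpow_natCast ‖z‖, ← rpow_add_of_nonneg (norm_nonneg z) hp (by norm_num)]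
    norm_num
  simp_rw [hrot _ ((stdOrthonormalBasis ℝ E).norm_eq_one _)] at hsum
  rw [Finset.sum_const, Finset.card_univ, Fintype.card_fin, nsmul_eq_mul,
    integral_norm_rpow_stdGaussian (by positivity)] at hsum
  rw [integral_norm_rpow_stdGaussian hp, div_mul_eq_mul_div, eq_div_iff hn.ne', mul_comm, hsum]
  have h1 : (p + 2 + Module.finrank ℝ E) / 2 = (p + Module.finrank ℝ E) / 2 + 1 := by ring
  rw [h1, Real.Gamma_add_one (by positivity), add_div, div_self two_ne_zero,
    rpow_add_one two_ne_zero]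
  ring

lemma integral_inner_stdGaussian (v : E) :
    ∫ z, ⟪v, z⟫ ∂(ProbabilityTheory.stdGaussian E) = 0 :=
  integral_strongDual_stdGaussian (innerSL ℝ v)

lemma integral_inner_mul_inner_stdGaussian (v w : E) :
    ∫ z, ⟪v, z⟫ * ⟪w, z⟫ ∂(ProbabilityTheory.stdGaussian E) = ⟪v, w⟫ := by
  have h1 := covarianceBilin_apply_eq_cov (μ := ProbabilityTheory.stdGaussian E)
    IsGaussian.memLp_two_id v w
  rw [covarianceBilin_stdGaussian, innerSL_apply_apply, covariance] at h1
  simp_rw [integral_inner_stdGaussian, sub_zero] at h1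
  exact h1.symm

lemma integral_norm_rpow_mul_abs_hermite_le [Nontrivial E] {p : ℝ} (hp : 0 ≤ p) {v w : E}
    (hv : ‖v‖ = 1) (hw : ‖w‖ = 1) :
    ∫ z, ‖z‖ ^ p * |⟪v, z⟫ * ⟪w, z⟫ - ⟪v, w⟫| ∂(ProbabilityTheory.stdGaussian E) ≤
      (p + 2 * Module.finrank ℝ E) / Module.finrank ℝ E *
        ∫ z, ‖z‖ ^ p ∂(ProbabilityTheory.stdGaussian E) := by
  have hn : (0 : ℝ) < Module.finrank ℝ E := by exact_mod_cast Module.finrank_pos (R := ℝ) (M := E)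
  have i1 := fun u : E => integrable_norm_rpow_mul_stdGaussian hp (f := fun z => ⟪u, z⟫ ^ 2)
    (by fun_prop) (by positivity) (sq_inner_le_one_add_norm u)
  have i0 : Integrable (fun z => ‖z‖ ^ p) (ProbabilityTheory.stdGaussian E) := by
    simpa using integrable_norm_rpow_mul_stdGaussian (E := E) hp (f := fun _ => 1)
      (by fun_prop) (A := 1) (n := 0) (by positivity) (by simp)
  have i2 : Integrable
      (fun z => (1 / 2) * (‖z‖ ^ p * ⟪v, z⟫ ^ 2) + (1 / 2) * (‖z‖ ^ p * ⟪w, z⟫ ^ 2))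
      (ProbabilityTheory.stdGaussian E) := ((i1 v).const_mul _).add ((i1 w).const_mul _)
  have hvw : |⟪v, w⟫| ≤ 1 := by simpa [hv, hw] using abs_real_inner_le_norm v w
  calc _ ≤ ∫ z, ((1 / 2) * (‖z‖ ^ p * ⟪v, z⟫ ^ 2) + (1 / 2) * (‖z‖ ^ p * ⟪w, z⟫ ^ 2)) + ‖z‖ ^ p
        ∂(ProbabilityTheory.stdGaussian E) := by
        refine integral_mono_of_nonneg (Eventually.of_forall fun z => by positivity)
          (i2.add i0)
          (Eventually.of_forall fun z => ?_)
        have h1 : |⟪v, z⟫ * ⟪w, z⟫ - ⟪v, w⟫| ≤ 1 / 2 * ⟪v, z⟫ ^ 2 + 1 / 2 * ⟪w, z⟫ ^ 2 + 1 := by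
          refine (abs_sub _ _).trans (add_le_add ?_ hvw)
          rw [abs_le]
          constructor <;> nlinarith [sq_nonneg (⟪v, z⟫ - ⟪w, z⟫), sq_nonneg (⟪v, z⟫ + ⟪w, z⟫)]
        calc _ ≤ ‖z‖ ^ p * (1 / 2 * ⟪v, z⟫ ^ 2 + 1 / 2 * ⟪w, z⟫ ^ 2 + 1) := by
              dsimp only; gcongr
          _ = _ := by ring
    _ = _ := by
        rw [integral_add i2 i0,
          integral_add ((i1 v).const_mul _) ((i1 w).const_mul _), integral_const_mul,
          integral_const_mul, integral_norm_rpow_mul_inner_sq_stdGaussian hp hv,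
          integral_norm_rpow_mul_inner_sq_stdGaussian hp hw]
        field_simp
        ring

lemma integrable_smul_of_abs_le_exp {F : Type*} [NormedAddCommGroup F] [NormedSpace ℝ F]
    {k : E → ℝ} (hk : Continuous k) {A : ℝ} (hA : ∀ z, |k z| ≤ A * Real.exp ‖z‖) (y : E) (s : ℝ)
    {L : E → F} (hL : Continuous L) {B : ℝ} {n : ℕ} (hB : 0 ≤ B)
    (hLB : ∀ z, ‖L z‖ ≤ B * (1 + ‖z‖) ^ n) :
    Integrable (fun z => k (y + s • z) • L z) (ProbabilityTheory.stdGaussian E) := by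
  have hA0 : 0 ≤ A := nonneg_of_mul_nonneg_left ((abs_nonneg _).trans (hA 0)) (Real.exp_pos _)
  refine integrable_of_norm_le_norm_mul_exp (by fun_prop) (A := A * Real.exp ‖y‖ * B) (c := |s|)
    (by positivity) n fun z => ?_
  rw [norm_smul, Real.norm_eq_abs]
  have h1 : |k (y + s • z)| ≤ A * (Real.exp ‖y‖ * Real.exp (|s| * ‖z‖)) := by
    refine (hA _).trans ?_
    rw [← Real.exp_add, ← Real.norm_eq_abs s, ← norm_smul]
    gcongr
    exact norm_add_le _ _
  calc _ ≤ A * (Real.exp ‖y‖ * Real.exp (|s| * ‖z‖)) * (B * (1 + ‖z‖) ^ n) := by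
        gcongr
        exact hLB z
    _ = _ := by ring

lemma hasFDerivAt_integral_comp_smul {k : E → ℝ} (hk : Continuous k) {A : ℝ}
    (hA : ∀ z, |k z| ≤ A * Real.exp ‖z‖) (a : ℝ) {s : ℝ} (hs : s ≠ 0) (x : E) :
    HasFDerivAt (fun x => ∫ z, k (a • x + s • z) ∂(ProbabilityTheory.stdGaussian E))
      ((a / s) • ∫ z, k (a • x + s • z) • innerSL ℝ z ∂(ProbabilityTheory.stdGaussian E)) x := by
  have h1 := hasFDerivAt_integral_stdGaussian_add (g := fun y => k (s • y)) (by fun_prop)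
    (A := A) (c := |s|) (fun z => by simpa [norm_smul] using hA (s • z)) ((a / s) • x)
  have h2 := h1.comp x ((hasFDerivAt_id x).const_smul (a / s))
  have h3 : ∀ x : E, s • (a / s) • x = a • x := fun x => by
    rw [smul_smul, mul_div_cancel₀ _ hs]
  simp only [smul_add, h3] at h2
  convert! h2 using 1
  · ext x
    simp [h3]
  · ext y
    simp

lemma hasFDerivAt_integral_comp_smul_mul_inner {k : E → ℝ} (hk : Continuous k) {A : ℝ}
    (hA : ∀ z, |k z| ≤ A * Real.exp ‖z‖) (a : ℝ) {s : ℝ} (hs : s ≠ 0) (v x : E) :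
    HasFDerivAt (fun x => ∫ z, k (a • x + s • z) * ⟪v, z⟫ ∂(ProbabilityTheory.stdGaussian E))
      ((a / s) • ∫ z, k (a • x + s • z) • (⟪v, z⟫ • innerSL ℝ z - innerSL ℝ v)
        ∂(ProbabilityTheory.stdGaussian E)) x := by
  have h1 := hasFDerivAt_integral_stdGaussian_add_mul_inner (g := fun y => k (s • y)) (by fun_prop)
    (A := A) (c := |s|) (abs_nonneg s) (fun z => by simpa [norm_smul] using hA (s • z)) v
    ((a / s) • x)
  have h2 := h1.comp x ((hasFDerivAt_id x).const_smul (a / s))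
  have h3 : ∀ x : E, s • (a / s) • x = a • x := fun x => by
    rw [smul_smul, mul_div_cancel₀ _ hs]
  simp only [smul_add, h3] at h2
  convert! h2 using 1
  · ext x
    simp [h3]
  · ext y
    simp

end Gaussian

section Holder

variable {E : Type*} [NormedAddCommGroup E] {k : E → ℝ} {C α : ℝ}

lemma continuous_of_abs_sub_le_rpow (hα : 0 < α) (hk : ∀ x y, |k x - k y| ≤ C * ‖x - y‖ ^ α) :
    Continuous k := by
  refine continuous_iff_continuousAt.2 fun y => tendsto_iff_norm_sub_tendsto_zero.2 ?_
  refine squeeze_zero (fun _ => norm_nonneg _) (fun x => hk x y) ?_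
  have : Continuous fun x : E => C * ‖x - y‖ ^ α :=
    continuous_const.mul (Continuous.rpow_const (by fun_prop) fun _ => .inr hα.le)
  simpa [zero_rpow hα.ne'] using this.tendsto y

lemma rpow_le_one_add {r : ℝ} (hr : 0 ≤ r) (hα : 0 ≤ α) (hα1 : α ≤ 1) : r ^ α ≤ 1 + r := by
  rcases le_total r 1 with h | h
  · exact (rpow_le_one hr h hα).trans (by linarith)
  · exact (rpow_le_rpow_of_exponent_le h hα1).trans (by rw [rpow_one]; linarith)

lemma abs_le_exp_norm_of_abs_sub_le_rpow (hC : 0 ≤ C) (hα : 0 ≤ α) (hα1 : α ≤ 1)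
    (hk : ∀ x y, |k x - k y| ≤ C * ‖x - y‖ ^ α) (z : E) :
    |k z| ≤ (|k 0| + C) * Real.exp ‖z‖ := by
  have h1 := hk z 0
  rw [sub_zero] at h1
  have h2 : C * ‖z‖ ^ α ≤ C * Real.exp ‖z‖ := by
    gcongr
    exact (rpow_le_one_add (norm_nonneg z) hα hα1).trans
      (by linarith [Real.add_one_le_exp ‖z‖])
  have h3 : |k 0| ≤ |k 0| * Real.exp ‖z‖ :=
    le_mul_of_one_le_right (abs_nonneg _) (Real.one_le_exp (norm_nonneg z))
  have h4 : |k z| ≤ |k z - k 0| + |k 0| := by simpa using abs_add_le (k z - k 0) (k 0)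
  linarith

variable [InnerProductSpace ℝ E] [FiniteDimensional ℝ E] [MeasurableSpace E] [BorelSpace E]

/-- A Gaussian mean against a centred weight is controlled by the Hölder seminorm. -/
lemma norm_integral_smul_le_of_abs_sub_le_rpow (hC : 0 ≤ C) (hα : 0 < α) (hα1 : α ≤ 1)
    (hk : ∀ x y, |k x - k y| ≤ C * ‖x - y‖ ^ α) {F : Type*} [NormedAddCommGroup F]
    [NormedSpace ℝ F] (y : E) {s : ℝ} (hs : 0 ≤ s)
    {L : E → F} (hL : Continuous L) {B : ℝ} {n : ℕ} (hB : 0 ≤ B)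
    (hLB : ∀ z, ‖L z‖ ≤ B * (1 + ‖z‖) ^ n)
    (hL0 : ∫ z, L z ∂(ProbabilityTheory.stdGaussian E) = 0) :
    ‖∫ z, k (y + s • z) • L z ∂(ProbabilityTheory.stdGaussian E)‖ ≤
      C * s ^ α * ∫ z, ‖z‖ ^ α * ‖L z‖ ∂(ProbabilityTheory.stdGaussian E) := by
  have hkc := continuous_of_abs_sub_le_rpow hα hk
  have h_int := integrable_smul_of_abs_le_exp hkc
    (abs_le_exp_norm_of_abs_sub_le_rpow hC hα.le hα1 hk) y s hL hB hLB
  have hLint : Integrable L (ProbabilityTheory.stdGaussian E) := by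
    refine integrable_of_norm_le_norm_mul_exp hL (c := 0) hB n fun z => ?_
    simpa using hLB z
  have h1 : ∫ z, k (y + s • z) • L z ∂(ProbabilityTheory.stdGaussian E) =
      ∫ z, (k (y + s • z) - k y) • L z ∂(ProbabilityTheory.stdGaussian E) := by
    have hLint' : Integrable (fun z => k y • L z) (ProbabilityTheory.stdGaussian E) :=
      hLint.smul (k y)
    simp_rw [sub_smul]
    rw [integral_sub h_int hLint', integral_smul, hL0, smul_zero, sub_zero]
  rw [h1, ← integral_const_mul]
  refine norm_integral_le_of_norm_le
    ((integrable_norm_rpow_mul_stdGaussian hα.le hL.norm hB (n := n) fun z => ?_).const_mul _)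
    (Eventually.of_forall fun z => ?_)
  · simpa using hLB z
  · rw [norm_smul, Real.norm_eq_abs, ← mul_assoc]
    gcongr
    refine (hk _ _).trans_eq ?_
    rw [add_sub_cancel_left, norm_smul, Real.norm_eq_abs, abs_of_nonneg hs,
      mul_rpow hs (norm_nonneg z), mul_assoc]

lemma integral_innerSL_stdGaussian :
    ∫ z, innerSL ℝ z ∂(ProbabilityTheory.stdGaussian E) = 0 := by
  rw [(innerSL ℝ (E := E)).integral_comp_id_comm IsGaussian.integrable_id,
    integral_id_stdGaussian, map_zero]

lemma norm_integral_smul_innerSL_le (hC : 0 ≤ C) (hα : 0 < α) (hα1 : α ≤ 1)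
    (hk : ∀ x y, |k x - k y| ≤ C * ‖x - y‖ ^ α) (y : E) {s : ℝ} (hs : 0 ≤ s) :
    ‖∫ z, k (y + s • z) • innerSL ℝ z ∂(ProbabilityTheory.stdGaussian E)‖ ≤
      C * s ^ α * ∫ z, ‖z‖ ^ α * ‖z‖ ∂(ProbabilityTheory.stdGaussian E) := by
  have := norm_integral_smul_le_of_abs_sub_le_rpow hC hα hα1 hk y hs (L := innerSL ℝ (E := E))
    (by fun_prop) (B := 1) (n := 1) one_pos.le (fun z => by simp [innerSL_apply_norm])
    integral_innerSL_stdGaussian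
  simpa only [innerSL_apply_norm] using this

lemma integral_comp_smul_mul_inner (hC : 0 ≤ C) (hα : 0 < α) (hα1 : α ≤ 1)
    (hk : ∀ x y, |k x - k y| ≤ C * ‖x - y‖ ^ α) (y v : E) (s : ℝ) :
    (∫ z, k (y + s • z) • innerSL ℝ z ∂(ProbabilityTheory.stdGaussian E)) v =
      ∫ z, k (y + s • z) * ⟪v, z⟫ ∂(ProbabilityTheory.stdGaussian E) := by
  rw [ContinuousLinearMap.integral_apply]
  · simp [real_inner_comm]
  · exact integrable_smul_of_abs_le_exp (continuous_of_abs_sub_le_rpow hα hk)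
      (abs_le_exp_norm_of_abs_sub_le_rpow hC hα.le hα1 hk) y s (by fun_prop) (B := 1) (n := 1)
      one_pos.le (fun z => by simp [innerSL_apply_norm])

lemma norm_integral_smul_hermite_le [Nontrivial E] (hC : 0 ≤ C) (hα : 0 < α) (hα1 : α ≤ 1)
    (hk : ∀ x y, |k x - k y| ≤ C * ‖x - y‖ ^ α) (y : E) {s : ℝ} (hs : 0 ≤ s) {v : E}
    (hv : ‖v‖ = 1) :
    ‖∫ z, k (y + s • z) • (⟪v, z⟫ • innerSL ℝ z - innerSL ℝ v)
        ∂(ProbabilityTheory.stdGaussian E)‖ ≤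
      C * s ^ α * ((α + 2 * Module.finrank ℝ E) / Module.finrank ℝ E *
        ∫ z, ‖z‖ ^ α ∂(ProbabilityTheory.stdGaussian E)) := by
  have hi := integrable_smul_of_abs_le_exp (continuous_of_abs_sub_le_rpow hα hk)
      (abs_le_exp_norm_of_abs_sub_le_rpow hC hα.le hα1 hk) y s
      (L := fun z => ⟪v, z⟫ • innerSL ℝ z - innerSL ℝ v)
      (by fun_prop) (by positivity) (norm_inner_smul_innerSL_sub_le v)
  refine ContinuousLinearMap.opNorm_le_of_unit_norm (by positivity) fun w hw => ?_
  rw [ContinuousLinearMap.integral_apply hi]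
  have h_int : Integrable (fun z => ⟪v, z⟫ * ⟪w, z⟫) (ProbabilityTheory.stdGaussian E) := by
    refine integrable_of_norm_le_norm_mul_exp (by fun_prop) (A := 1) (c := 0) one_pos.le 2
      fun z => ?_
    rw [norm_mul, zero_mul, Real.exp_zero, one_mul, one_mul, sq]
    gcongr
    · refine (norm_inner_le_norm v z).trans ?_
      rw [hv]; linarith
    · refine (norm_inner_le_norm w z).trans ?_
      rw [hw]; linarith
  have h0 : ∫ z, (⟪v, z⟫ * ⟪w, z⟫ - ⟪v, w⟫) ∂(ProbabilityTheory.stdGaussian E) = 0 := by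
    rw [integral_sub h_int (integrable_const _), integral_inner_mul_inner_stdGaussian]
    simp
  have h1 := norm_integral_smul_le_of_abs_sub_le_rpow hC hα hα1 hk y hs
    (L := fun z => ⟪v, z⟫ * ⟪w, z⟫ - ⟪v, w⟫) (by fun_prop) (B := 2 * ‖v‖) (n := 2)
    (by positivity) (fun z => by
      have := (⟪v, z⟫ • innerSL ℝ z - innerSL ℝ v).le_opNorm w
      rw [hw, mul_one] at this
      refine le_trans (le_of_eq ?_) (this.trans (norm_inner_smul_innerSL_sub_le v z))
      simp [real_inner_comm]) h0
  refine le_trans (le_of_eq ?_) (h1.trans ?_)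
  · simp [real_inner_comm]
  · gcongr
    exact integral_norm_rpow_mul_abs_hermite_le hα.le hv hw

lemma integrableOn_one_sub_rpow {r : ℝ} (hr : -1 < r) :
    IntegrableOn (fun t : ℝ => (1 - t) ^ r) (Ioo 0 1) := by
  have h1 : IntervalIntegrable (fun t : ℝ => (1 - t) ^ r) volume 0 1 := by
    simpa using ((intervalIntegral.intervalIntegrable_rpow' (a := 0) (b := 1) hr).comp_sub_left
      1).symm
  exact ((intervalIntegrable_iff_integrableOn_Ioc_of_le zero_le_one).1 h1).mono_set
    Ioo_subset_Ioc_self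

lemma integral_one_sub_rpow {r : ℝ} (hr : -1 < r) :
    ∫ t in Ioo (0 : ℝ) 1, (1 - t) ^ r = 1 / (r + 1) := by
  rw [← integral_Ioc_eq_integral_Ioo, ← intervalIntegral.integral_of_le zero_le_one,
    intervalIntegral.integral_comp_sub_left (fun t => t ^ r), integral_rpow (.inl hr)]
  simp [zero_rpow (by linarith : r + 1 ≠ 0)]

lemma gradient_weight_le {t : ℝ} (ht : t ∈ Ioo (0 : ℝ) 1) :
    1 / (2 * t) * (√t / √(1 - t)) ≤ t ^ (-1 / 2 : ℝ) + (1 - t) ^ (-1 / 2 : ℝ) := by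
  have h0 : 0 < t := ht.1
  have h1 : 0 < 1 - t := sub_pos.2 ht.2
  rw [neg_div, rpow_neg h0.le, rpow_neg h1.le, ← sqrt_eq_rpow, ← sqrt_eq_rpow]
  have ha := sqrt_pos.2 h0
  have hb := sqrt_pos.2 h1
  have ha1 : √t ≤ 1 := sqrt_le_one.2 ht.2.le
  have hb1 : √(1 - t) ≤ 1 := sqrt_le_one.2 (by linarith)
  have hab : √t ^ 2 + √(1 - t) ^ 2 = 1 := by rw [sq_sqrt h0.le, sq_sqrt h1.le]; ring
  have : 1 / (2 * t) * (√t / √(1 - t)) = 1 / (2 * √t * √(1 - t)) := by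
    field_simp
    exact sq_sqrt h0.le
  rw [this, inv_add_inv ha.ne' hb.ne', div_le_div_iff₀ (by positivity) (by positivity)]
  have : 1 ≤ (√t + √(1 - t)) * 2 := by nlinarith
  have h2 : 0 ≤ √t * √(1 - t) := by positivity
  nlinarith

lemma hessian_weight_eq {t : ℝ} (ht : t ∈ Ioo (0 : ℝ) 1) (α : ℝ) :
    1 / (2 * t) * (√t / √(1 - t)) * (√t / √(1 - t)) * √(1 - t) ^ α =
      1 / 2 * (1 - t) ^ (α / 2 - 1) := by
  have h0 : 0 < t := ht.1
  have h1 : 0 < 1 - t := sub_pos.2 ht.2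
  rw [rpow_sub_one h1.ne', sqrt_eq_rpow (1 - t), ← rpow_mul h1.le, mul_assoc (1 / (2 * t)),
    div_mul_div_comm, mul_self_sqrt h0.le, ← sqrt_eq_rpow, mul_self_sqrt h1.le,
    one_div_mul_eq_div]
  field_simp

lemma aestronglyMeasurable_integral_stdGaussian {F : Type*} [NormedAddCommGroup F]
    [NormedSpace ℝ F] {Φ : ℝ × E → F} (hΦ : Continuous Φ) (ν : Measure ℝ) :
    AEStronglyMeasurable (fun t => ∫ z, Φ (t, z) ∂(ProbabilityTheory.stdGaussian E)) ν :=
  (hΦ.stronglyMeasurable.integral_prod_right' (ν := ProbabilityTheory.stdGaussian E)).aestronglyMeasurable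

lemma abs_mehler_le (hC : 0 ≤ C) (hα : 0 < α) (hα1 : α ≤ 1)
    (hk : ∀ x y, |k x - k y| ≤ C * ‖x - y‖ ^ α)
    (hk0 : ∫ z, k z ∂(ProbabilityTheory.stdGaussian E) = 0) (x : E) {t : ℝ}
    (ht : t ∈ Ioo (0 : ℝ) 1) :
    |∫ z, k (√t • x + √(1 - t) • z) ∂(ProbabilityTheory.stdGaussian E)| ≤
      t ^ (α / 2) * (C * (1 + ‖x‖ + ∫ z, ‖z‖ ∂(ProbabilityTheory.stdGaussian E))) := by
  have hkc := continuous_of_abs_sub_le_rpow hα hk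
  have hkb := abs_le_exp_norm_of_abs_sub_le_rpow hC hα.le hα1 hk
  have i1 : Integrable (fun z => k (√t • x + √(1 - t) • z)) (ProbabilityTheory.stdGaussian E) := by
    simpa using integrable_smul_of_abs_le_exp hkc hkb (√t • x) (√(1 - t)) (L := fun _ => (1 : ℝ))
      (by fun_prop) (B := 1) (n := 0) one_pos.le (by simp)
  have i2 : Integrable k (ProbabilityTheory.stdGaussian E) := by
    simpa using integrable_smul_of_abs_le_exp hkc hkb 0 1 (L := fun _ => (1 : ℝ))
      (by fun_prop) (B := 1) (n := 0) one_pos.le (by simp)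
  have i3 : Integrable (fun z => ‖z‖) (ProbabilityTheory.stdGaussian E) :=
    IsGaussian.integrable_id.norm
  have h1 : ∫ z, k (√t • x + √(1 - t) • z) ∂(ProbabilityTheory.stdGaussian E) =
      ∫ z, (k (√t • x + √(1 - t) • z) - k z) ∂(ProbabilityTheory.stdGaussian E) := by
    rw [integral_sub i1 i2, hk0, sub_zero]
  have h2 : 1 + ‖x‖ + ∫ z, ‖z‖ ∂(ProbabilityTheory.stdGaussian E) =
      ∫ z, (1 + ‖x‖ + ‖z‖) ∂(ProbabilityTheory.stdGaussian E) := by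
    rw [integral_add (integrable_const _) i3]; simp
  rw [h1, ← Real.norm_eq_abs, h2, ← integral_const_mul, ← integral_const_mul]
  refine norm_integral_le_of_norm_le ((((integrable_const _).add i3).const_mul _).const_mul _)
    (Eventually.of_forall fun z => (hk _ _).trans ?_)
  have h0 : 0 < t := ht.1
  have h3 : 0 < 1 - t := sub_pos.2 ht.2
  have hb1 : √(1 - t) ≤ 1 := sqrt_le_one.2 (by linarith)
  have hab : 1 - √(1 - t) ≤ √t := by
    nlinarith [sq_sqrt h0.le, sq_sqrt h3.le, sqrt_nonneg t, sqrt_nonneg (1 - t)]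
  have h4 : ‖√t • x + √(1 - t) • z - z‖ ≤ √t * (‖x‖ + ‖z‖) := by
    have : √t • x + √(1 - t) • z - z = √t • x - (1 - √(1 - t)) • z := by
      rw [sub_smul, one_smul]; abel
    rw [this]
    refine (norm_sub_le _ _).trans ?_
    rw [norm_smul, norm_smul, Real.norm_eq_abs, Real.norm_eq_abs, abs_of_nonneg (sqrt_nonneg t),
      abs_of_nonneg (by linarith), mul_add]
    gcongr
  calc C * ‖√t • x + √(1 - t) • z - z‖ ^ α ≤ C * (√t * (‖x‖ + ‖z‖)) ^ α := by gcongr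
    _ = t ^ (α / 2) * (C * (‖x‖ + ‖z‖) ^ α) := by
        rw [mul_rpow (sqrt_nonneg t) (by positivity), sqrt_eq_rpow, ← rpow_mul h0.le]
        ring_nf
    _ ≤ _ := by
        gcongr
        rw [add_assoc]
        exact rpow_le_one_add (by positivity) hα.le hα1

lemma norm_gradient_integrand_le (hC : 0 ≤ C) (hα : 0 < α) (hα1 : α ≤ 1)
    (hk : ∀ x y, |k x - k y| ≤ C * ‖x - y‖ ^ α) (x : E) {t : ℝ} (ht : t ∈ Ioo (0 : ℝ) 1) :
    ‖(1 / (2 * t) * (√t / √(1 - t))) • ∫ z, k (√t • x + √(1 - t) • z) • innerSL ℝ z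
      ∂(ProbabilityTheory.stdGaussian E)‖ ≤
      (t ^ (-1 / 2 : ℝ) + (1 - t) ^ (-1 / 2 : ℝ)) *
        (C * ∫ z, ‖z‖ ^ α * ‖z‖ ∂(ProbabilityTheory.stdGaussian E)) := by
  have h0 : 0 < t := ht.1
  have h1 : 0 < 1 - t := sub_pos.2 ht.2
  rw [norm_smul, Real.norm_eq_abs, abs_of_nonneg (by positivity)]
  have hM : 0 ≤ ∫ z, ‖z‖ ^ α * ‖z‖ ∂(ProbabilityTheory.stdGaussian E) :=
    integral_nonneg fun z => by positivity
  gcongr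
  · exact gradient_weight_le ht
  · refine (norm_integral_smul_innerSL_le hC hα hα1 hk _ (sqrt_nonneg _)).trans ?_
    gcongr
    exact mul_le_of_le_one_right hC
      (rpow_le_one (sqrt_nonneg _) (sqrt_le_one.2 (by linarith)) hα.le)

lemma integrableOn_gradient_bound (M : ℝ) :
    IntegrableOn (fun t : ℝ => (t ^ (-1 / 2 : ℝ) + (1 - t) ^ (-1 / 2 : ℝ)) * M) (Ioo 0 1) :=
  (((intervalIntegral.integrableOn_Ioo_rpow_iff one_pos).2 (by norm_num)).add
    (integrableOn_one_sub_rpow (by norm_num))).mul_const M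

lemma aestronglyMeasurable_gradient_integrand (hα : 0 < α)
    (hk : ∀ x y, |k x - k y| ≤ C * ‖x - y‖ ^ α) {F : Type*} [NormedAddCommGroup F]
    [NormedSpace ℝ F] {L : E → F} (hL : Continuous L) {w : ℝ → ℝ} (hw : Measurable w) (x : E)
    (ν : Measure ℝ) :
    AEStronglyMeasurable (fun t => w t • ∫ z, k (√t • x + √(1 - t) • z) • L z
      ∂(ProbabilityTheory.stdGaussian E)) ν := by
  have hkc := continuous_of_abs_sub_le_rpow hα hk
  exact hw.aestronglyMeasurable.smul (aestronglyMeasurable_integral_stdGaussian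
    (Φ := fun p => k (√p.1 • x + √(1 - p.1) • p.2) • L p.2) (by fun_prop) ν)

/-- Differentiation of Barbour's solution under the time integral. -/
lemma hasFDerivAt_barbour (hC : 0 ≤ C) (hα : 0 < α) (hα1 : α ≤ 1)
    (hk : ∀ x y, |k x - k y| ≤ C * ‖x - y‖ ^ α)
    (hk0 : ∫ z, k z ∂(ProbabilityTheory.stdGaussian E) = 0) (x : E) :
    HasFDerivAt (fun x => ∫ t in Ioo (0 : ℝ) 1, (1 / (2 * t)) *
        ∫ z, k (√t • x + √(1 - t) • z) ∂(ProbabilityTheory.stdGaussian E))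
      (∫ t in Ioo (0 : ℝ) 1, (1 / (2 * t) * (√t / √(1 - t))) •
        ∫ z, k (√t • x + √(1 - t) • z) • innerSL ℝ z ∂(ProbabilityTheory.stdGaussian E)) x := by
  have hkc := continuous_of_abs_sub_le_rpow hα hk
  have hkb := abs_le_exp_norm_of_abs_sub_le_rpow hC hα.le hα1 hk
  have hmeas : ∀ x : E, AEStronglyMeasurable (fun t => (1 / (2 * t)) *
      ∫ z, k (√t • x + √(1 - t) • z) ∂(ProbabilityTheory.stdGaussian E))
      (volume.restrict (Ioo 0 1)) := fun x => by
    simpa using aestronglyMeasurable_gradient_integrand hα hk (L := fun _ => (1 : ℝ))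
      (by fun_prop) (w := fun t => 1 / (2 * t)) (by fun_prop) x (volume.restrict (Ioo 0 1))
  refine hasFDerivAt_integral_of_dominated_of_fderiv_le (s := univ)
    (F' := fun x t => (1 / (2 * t) * (√t / √(1 - t))) •
        ∫ z, k (√t • x + √(1 - t) • z) • innerSL ℝ z ∂(ProbabilityTheory.stdGaussian E))
    univ_mem (Eventually.of_forall hmeas) ?_
    (aestronglyMeasurable_gradient_integrand hα hk (by fun_prop) (by fun_prop) x _)
    ((ae_restrict_mem measurableSet_Ioo).mono fun t ht x _ =>
      norm_gradient_integrand_le hC hα hα1 hk x ht)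
    (integrableOn_gradient_bound _)
    ((ae_restrict_mem measurableSet_Ioo).mono fun t ht x _ => ?_)
  · set M := C * (1 + ‖x‖ + ∫ z, ‖z‖ ∂(ProbabilityTheory.stdGaussian E))
    have h_int : IntegrableOn (fun t : ℝ => 1 / 2 * M * t ^ (α / 2 - 1)) (Ioo 0 1) :=
      ((intervalIntegral.integrableOn_Ioo_rpow_iff one_pos).2 (by linarith)).const_mul _
    refine Integrable.mono' h_int (hmeas x) ((ae_restrict_mem measurableSet_Ioo).mono fun t ht => ?_)
    have h0 : 0 < t := ht.1
    rw [norm_mul, Real.norm_eq_abs, Real.norm_eq_abs, abs_of_nonneg (by positivity),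
      rpow_sub_one h0.ne']
    calc _ ≤ 1 / (2 * t) * (t ^ (α / 2) * M) := by
          gcongr
          exact abs_mehler_le hC hα hα1 hk hk0 x ht
      _ = _ := by ring
  · have := (hasFDerivAt_integral_comp_smul hkc hkb (√t) (sqrt_pos.2 (sub_pos.2 ht.2)).ne'
      x).const_mul (1 / (2 * t))
    rwa [smul_smul] at this

lemma norm_hessian_integrand_le [Nontrivial E] (hC : 0 ≤ C) (hα : 0 < α) (hα1 : α ≤ 1)
    (hk : ∀ x y, |k x - k y| ≤ C * ‖x - y‖ ^ α) {v : E} (hv : ‖v‖ = 1) (x : E) {t : ℝ}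
    (ht : t ∈ Ioo (0 : ℝ) 1) :
    ‖(1 / (2 * t) * (√t / √(1 - t)) * (√t / √(1 - t))) • ∫ z, k (√t • x + √(1 - t) • z) •
      (⟪v, z⟫ • innerSL ℝ z - innerSL ℝ v) ∂(ProbabilityTheory.stdGaussian E)‖ ≤
      (1 / 2 * (1 - t) ^ (α / 2 - 1)) *
        (C * ((α + 2 * Module.finrank ℝ E) / Module.finrank ℝ E *
          ∫ z, ‖z‖ ^ α ∂(ProbabilityTheory.stdGaussian E))) := by
  have h0 : 0 < t := ht.1
  have h1 : 0 < 1 - t := sub_pos.2 ht.2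
  rw [norm_smul, Real.norm_eq_abs, abs_of_nonneg (by positivity), ← hessian_weight_eq ht α]
  refine (mul_le_mul_of_nonneg_left
    (norm_integral_smul_hermite_le hC hα hα1 hk _ (sqrt_nonneg _) hv) (by positivity)).trans_eq ?_
  ring

lemma hasFDerivAt_gradient_barbour [Nontrivial E] (hC : 0 ≤ C) (hα : 0 < α) (hα1 : α ≤ 1)
    (hk : ∀ x y, |k x - k y| ≤ C * ‖x - y‖ ^ α) {v : E} (hv : ‖v‖ = 1) (x : E) :
    HasFDerivAt (fun x => ∫ t in Ioo (0 : ℝ) 1, (1 / (2 * t) * (√t / √(1 - t))) *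
        ∫ z, k (√t • x + √(1 - t) • z) * ⟪v, z⟫ ∂(ProbabilityTheory.stdGaussian E))
      (∫ t in Ioo (0 : ℝ) 1, (1 / (2 * t) * (√t / √(1 - t)) * (√t / √(1 - t))) •
        ∫ z, k (√t • x + √(1 - t) • z) • (⟪v, z⟫ • innerSL ℝ z - innerSL ℝ v)
          ∂(ProbabilityTheory.stdGaussian E)) x := by
  have hkc := continuous_of_abs_sub_le_rpow hα hk
  have hkb := abs_le_exp_norm_of_abs_sub_le_rpow hC hα.le hα1 hk
  have hmeas : ∀ x : E, AEStronglyMeasurable (fun t => (1 / (2 * t) * (√t / √(1 - t))) *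
      ∫ z, k (√t • x + √(1 - t) • z) * ⟪v, z⟫ ∂(ProbabilityTheory.stdGaussian E))
      (volume.restrict (Ioo 0 1)) := fun x =>
    aestronglyMeasurable_gradient_integrand hα hk (L := fun z => ⟪v, z⟫)
      (by fun_prop) (w := fun t => 1 / (2 * t) * (√t / √(1 - t))) (by fun_prop) x _
  refine hasFDerivAt_integral_of_dominated_of_fderiv_le (s := univ)
    (F' := fun x t => (1 / (2 * t) * (√t / √(1 - t)) * (√t / √(1 - t))) •
        ∫ z, k (√t • x + √(1 - t) • z) • (⟪v, z⟫ • innerSL ℝ z - innerSL ℝ v)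
          ∂(ProbabilityTheory.stdGaussian E))
    univ_mem (Eventually.of_forall hmeas) ?_
    (aestronglyMeasurable_gradient_integrand hα hk (by fun_prop) (by fun_prop) x _)
    ((ae_restrict_mem measurableSet_Ioo).mono fun t ht x _ =>
      norm_hessian_integrand_le hC hα hα1 hk hv x ht)
    (((integrableOn_one_sub_rpow (by linarith)).const_mul _).mul_const _)
    ((ae_restrict_mem measurableSet_Ioo).mono fun t ht x _ => ?_)
  · refine Integrable.mono' (integrableOn_gradient_bound
      (C * ∫ z, ‖z‖ ^ α * ‖z‖ ∂(ProbabilityTheory.stdGaussian E))) (hmeas x)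
      ((ae_restrict_mem measurableSet_Ioo).mono fun t ht => ?_)
    refine le_trans ?_ (norm_gradient_integrand_le hC hα hα1 hk x ht)
    rw [← integral_comp_smul_mul_inner hC hα hα1 hk, ← smul_eq_mul,
      ← _root_.smul_apply]
    exact (ContinuousLinearMap.le_opNorm _ _).trans_eq (by rw [hv, mul_one])
  · have := (hasFDerivAt_integral_comp_smul_mul_inner hkc hkb (√t)
      (sqrt_pos.2 (sub_pos.2 ht.2)).ne' v x).const_mul (1 / (2 * t) * (√t / √(1 - t)))
    rwa [smul_smul] at this

lemma fderiv_barbour_apply (hC : 0 ≤ C) (hα : 0 < α) (hα1 : α ≤ 1)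
    (hk : ∀ x y, |k x - k y| ≤ C * ‖x - y‖ ^ α)
    (hk0 : ∫ z, k z ∂(ProbabilityTheory.stdGaussian E) = 0) (x v : E) :
    fderiv ℝ (fun x => ∫ t in Ioo (0 : ℝ) 1, (1 / (2 * t)) *
        ∫ z, k (√t • x + √(1 - t) • z) ∂(ProbabilityTheory.stdGaussian E)) x v =
      ∫ t in Ioo (0 : ℝ) 1, (1 / (2 * t) * (√t / √(1 - t))) *
        ∫ z, k (√t • x + √(1 - t) • z) * ⟪v, z⟫ ∂(ProbabilityTheory.stdGaussian E) := by
  rw [(hasFDerivAt_barbour hC hα hα1 hk hk0 x).fderiv, ContinuousLinearMap.integral_apply]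
  · simp_rw [_root_.smul_apply, integral_comp_smul_mul_inner hC hα hα1 hk,
      smul_eq_mul]
  · exact Integrable.mono' (integrableOn_gradient_bound _)
      (aestronglyMeasurable_gradient_integrand hα hk (by fun_prop) (by fun_prop) x _)
      ((ae_restrict_mem measurableSet_Ioo).mono fun t ht =>
        norm_gradient_integrand_le hC hα hα1 hk x ht)

lemma norm_hessian_barbour_le [Nontrivial E] (hC : 0 ≤ C) (hα : 0 < α) (hα1 : α ≤ 1)
    (hk : ∀ x y, |k x - k y| ≤ C * ‖x - y‖ ^ α) {v : E} (hv : ‖v‖ = 1) (x : E) :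
    ‖∫ t in Ioo (0 : ℝ) 1, (1 / (2 * t) * (√t / √(1 - t)) * (√t / √(1 - t))) •
        ∫ z, k (√t • x + √(1 - t) • z) • (⟪v, z⟫ • innerSL ℝ z - innerSL ℝ v)
          ∂(ProbabilityTheory.stdGaussian E)‖ ≤
      2 ^ (α / 2) * ((α + 2 * Module.finrank ℝ E) / (α * Module.finrank ℝ E)) *
        Real.Gamma ((α + Module.finrank ℝ E) / 2) / Real.Gamma (Module.finrank ℝ E / 2) * C := by
  refine (norm_integral_le_of_norm_le
    (((integrableOn_one_sub_rpow (by linarith)).const_mul _).mul_const _)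
    ((ae_restrict_mem measurableSet_Ioo).mono fun t ht =>
      norm_hessian_integrand_le hC hα hα1 hk hv x ht)).trans_eq ?_
  rw [integral_mul_const, integral_const_mul, integral_one_sub_rpow (by linarith),
    integral_norm_rpow_stdGaussian hα.le]
  have hn : (0 : ℝ) < Module.finrank ℝ E := by exact_mod_cast Module.finrank_pos (R := ℝ) (M := E)
  rw [sub_add_cancel]
  field_simp

end Holder


lemma integral_hbar_eq_zero {d : ℕ} {h : EuclideanSpace ℝ (Fin d) → ℝ}
    (hi : Integrable h (_root_.stdGaussian d)) [IsProbabilityMeasure (_root_.stdGaussian d)] :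
    ∫ z, hbar d h z ∂(_root_.stdGaussian d) = 0 := by
  simp only [hbar]
  rw [integral_sub hi (integrable_const _)]
  simp

lemma stdGaussian_eq_stdGaussian_euclideanSpace (d : ℕ) :
    _root_.stdGaussian d = ProbabilityTheory.stdGaussian (EuclideanSpace ℝ (Fin d)) :=
  map_pi_eq_stdGaussian

/-- The operator norm of a Hessian is controlled by the derivatives of the directional
derivatives in unit directions. -/
lemma matOpNorm_hessMatrix_le {d : ℕ} {f : EuclideanSpace ℝ (Fin d) → ℝ} {K : ℝ} (hK : 0 ≤ K)
    {x : EuclideanSpace ℝ (Fin d)}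
    (hd : ∀ v, ‖v‖ = 1 → DifferentiableAt ℝ (fun y => fderiv ℝ f y v) x)
    (hb : ∀ v, ‖v‖ = 1 → ‖fderiv ℝ (fun y => fderiv ℝ f y v) x‖ ≤ K) :
    matOpNorm (hessMatrix f x) ≤ K := by
  refine Real.sSup_le ?_ hK
  rintro _ ⟨v, hv, rfl⟩
  set L := fderiv ℝ (fun y => fderiv ℝ f y v) x with hL
  have hsum : ∀ u : EuclideanSpace ℝ (Fin d), u = ∑ i, u i • EuclideanSpace.single i (1 : ℝ) :=
    fun u => by simpa using ((EuclideanSpace.basisFun (Fin d) ℝ).sum_repr u).symm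
  have hi : ∀ i, (hessMatrix f x).mulVec (WithLp.equiv 2 (Fin d → ℝ) v) i =
      L (EuclideanSpace.single i 1) := by
    intro i
    have h1 : (fun y => fderiv ℝ f y v) =
        fun y => ∑ j, v j * fderiv ℝ f y (EuclideanSpace.single j 1) := by
      ext y
      conv_lhs => rw [hsum v]
      simp
    have h2 : ∀ j, DifferentiableAt ℝ
        (fun y => fderiv ℝ f y (EuclideanSpace.single j (1 : ℝ))) x := fun j => hd _ (by simp)
    rw [hL, h1, fderiv_fun_sum fun j _ => (h2 j).const_mul _, _root_.sum_apply]
    change ∑ j, hessEntry f x i j * v j = _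
    refine Finset.sum_congr rfl fun j _ => ?_
    rw [fderiv_const_mul (h2 j), _root_.smul_apply, smul_eq_mul, mul_comm]
    rfl
  set w := (WithLp.equiv 2 (Fin d → ℝ)).symm
    ((hessMatrix f x).mulVec (WithLp.equiv 2 (Fin d → ℝ) v)) with hw
  have hwi : ∀ i, w i = L (EuclideanSpace.single i 1) := hi
  have h3 : ‖w‖ ^ 2 = L w := by
    conv_rhs => rw [hsum w]
    rw [EuclideanSpace.norm_sq_eq]
    simp [sq, ← hwi]
  have h4 : L w ≤ K * ‖w‖ := (le_abs_self _).trans (L.le_of_opNorm_le (hb v hv) w)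
  rcases (norm_nonneg w).eq_or_lt with h0 | h0
  · rwa [← h0]
  · exact le_of_mul_le_mul_right (by rwa [← sq, h3]) h0

/-- The Hessian of Barbour's solution is uniformly bounded in operator norm:
`‖∇²f_h(x)‖_op ≤ 2^{α/2} ((α+2d)/(αd)) Γ((α+d)/2)/Γ(d/2) · [h]_α`. -/
theorem steinSol_hessian_opNorm_le
    {d : ℕ} (hd : 1 ≤ d) {α : ℝ} (hα : α ∈ Set.Ioc (0 : ℝ) 1)
    (h : EuclideanSpace ℝ (Fin d) → ℝ)
    {C : ℝ} (hC0 : 0 ≤ C) (hC : HolderConst α C h) :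
    ∀ x : EuclideanSpace ℝ (Fin d),
      matOpNorm (hessMatrix (steinSol d h) x) ≤
        2 ^ (α / 2) * ((α + 2 * d) / (α * d)) * Real.Gamma ((α + d) / 2) /
            Real.Gamma (d / 2) * C := by
  obtain ⟨hα0, hα1⟩ := hα
  intro x
  have : Nonempty (Fin d) := ⟨⟨0, hd⟩⟩
  have hγ := stdGaussian_eq_stdGaussian_euclideanSpace d
  have : IsProbabilityMeasure (_root_.stdGaussian d) := hγ ▸ inferInstance
  have hh : ∀ x y, |h x - h y| ≤ C * ‖x - y‖ ^ α := fun x y => dist_eq_norm x y ▸ hC x y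
  have hi : Integrable h (_root_.stdGaussian d) := by
    rw [hγ]
    exact integrable_of_norm_le_exp (continuous_of_abs_sub_le_rpow hα0 hh) (c := 1)
      (by simpa using abs_le_exp_norm_of_abs_sub_le_rpow hC0 hα0.le hα1 hh)
  have hk : ∀ x y, |hbar d h x - hbar d h y| ≤ C * ‖x - y‖ ^ α := fun x y => by
    simpa [hbar] using hh x y
  have hk0 := integral_hbar_eq_zero hi
  have hf : ∀ y v, fderiv ℝ (steinSol d h) y v = -_ := fun y v => by
    unfold steinSol
    rw [hγ] at hk0 ⊢
    rw [fderiv_fun_neg, _root_.neg_apply, fderiv_barbour_apply hC0 hα0 hα1 hk hk0]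
  have hv : ∀ v : EuclideanSpace ℝ (Fin d), ‖v‖ = 1 → HasFDerivAt
      (fun y => fderiv ℝ (steinSol d h) y v) _ x := fun v hv => by
    simp_rw [hf]
    exact (hasFDerivAt_gradient_barbour hC0 hα0 hα1 hk hv x).neg
  refine matOpNorm_hessMatrix_le (by positivity) (fun v h1 => (hv v h1).differentiableAt)
    fun v h1 => ?_
  rw [(hv v h1).fderiv, norm_neg]
  simpa using norm_hessian_barbour_le hC0 hα0 hα1 hk h1 x
end

section
/- As u → 0⁺, the integral ∫₀^{1/u²} ( √(1 − u² t) / t ) e^{−1/t} dt is asymptotically equivalent to −2 log u; that is, the ratio of the integral to −2 log u tends to 1 as u → 0⁺. -/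
open MeasureTheory ProbabilityTheory Real Filter Set

theorem exp_neg_one_div_div_le_one {t : ℝ} (ht : 0 < t) : Real.exp (-1 / t) / t ≤ 1 := by
  rw [div_le_one ht, neg_div, Real.exp_neg]
  refine inv_le_of_inv_le₀ ht ?_
  rw [one_div]
  linarith [Real.add_one_le_exp t⁻¹]

theorem sqrt_mul_exp_div_nonneg (c : ℝ) {t : ℝ} (ht : 0 < t) :
    0 ≤ Real.sqrt (1 - c * t) * Real.exp (-1 / t) / t := by
  positivity

theorem sqrt_mul_exp_div_le {c t : ℝ} (hc : 0 < c) (ht : 0 < t) :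
    Real.sqrt (1 - c * t) * Real.exp (-1 / t) / t ≤ Real.exp (-1 / t) / t := by
  have h : Real.sqrt (1 - c * t) ≤ 1 := Real.sqrt_le_one.2 (by nlinarith [mul_pos hc ht])
  gcongr
  exact mul_le_of_le_one_left (Real.exp_pos _).le h

theorem le_sqrt_mul_exp_div {c t : ℝ} (hc : 0 < c) (ht : 1 ≤ t) (hct : c * t ≤ 1) :
    t⁻¹ - (t ^ 2)⁻¹ - c ≤ Real.sqrt (1 - c * t) * Real.exp (-1 / t) / t := by
  have ht0 : 0 < t := by linarith
  have hs : 1 - c * t ≤ Real.sqrt (1 - c * t) :=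
    Real.le_sqrt_of_sq_le (by nlinarith [mul_pos hc ht0])
  have he : 1 - t⁻¹ ≤ Real.exp (-1 / t) := by
    have := Real.add_one_le_exp (-1 / t)
    rw [neg_div, one_div] at this ⊢
    linarith
  have hinv : 0 ≤ 1 - t⁻¹ := sub_nonneg.2 (inv_le_one_of_one_le₀ ht)
  calc t⁻¹ - (t ^ 2)⁻¹ - c ≤ t⁻¹ - (t ^ 2)⁻¹ - c + c * t⁻¹ := by
        linarith [mul_pos hc (inv_pos.2 ht0)]
    _ = (1 - c * t) * (1 - t⁻¹) / t := by field_simp; ring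
    _ ≤ _ := by gcongr

theorem integrableOn_sqrt_mul_exp_div {c : ℝ} (hc : 0 < c) (b : ℝ) :
    IntegrableOn (fun t : ℝ => Real.sqrt (1 - c * t) * Real.exp (-1 / t) / t) (Ioc 0 b) := by
  refine Measure.integrableOn_of_bounded (M := 1) measure_Ioc_lt_top.ne
    (Measurable.aestronglyMeasurable (by fun_prop)) ?_
  filter_upwards [ae_restrict_mem measurableSet_Ioc] with t ht
  rw [Real.norm_of_nonneg (sqrt_mul_exp_div_nonneg c ht.1)]
  exact (sqrt_mul_exp_div_le hc ht.1).trans (exp_neg_one_div_div_le_one ht.1)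

theorem integral_sqrt_mul_exp_div_bounds {c : ℝ} (hc : 0 < c) (hc1 : c < 1) :
    -Real.log c - 2 ≤
        ∫ t in Ioo (0 : ℝ) (1 / c), Real.sqrt (1 - c * t) * Real.exp (-1 / t) / t ∧
      ∫ t in Ioo (0 : ℝ) (1 / c), Real.sqrt (1 - c * t) * Real.exp (-1 / t) / t ≤
        -Real.log c + 1 := by
  set f : ℝ → ℝ := fun t => Real.sqrt (1 - c * t) * Real.exp (-1 / t) / t
  have hN : 1 ≤ 1 / c := (one_le_div hc).2 hc1.le
  have hfi : IntervalIntegrable f volume 0 1 :=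
    (intervalIntegrable_iff_integrableOn_Ioc_of_le zero_le_one).2
      (integrableOn_sqrt_mul_exp_div hc 1)
  have hfi' : IntervalIntegrable f volume 1 (1 / c) :=
    (intervalIntegrable_iff_integrableOn_Ioc_of_le hN).2
      ((integrableOn_sqrt_mul_exp_div hc _).mono_set (Ioc_subset_Ioc_left zero_le_one))
  have hsplit : ∫ t in Ioo (0 : ℝ) (1 / c), f t =
      (∫ t in (0 : ℝ)..1, f t) + ∫ t in (1 : ℝ)..(1 / c), f t := by
    rw [intervalIntegral.integral_add_adjacent_intervals hfi hfi',
      intervalIntegral.integral_of_le (by linarith), integral_Ioc_eq_integral_Ioo]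
  have hpos : ∀ t ∈ uIcc 1 (1 / c), 0 < t := fun t ht => by
    rw [uIcc_of_le hN] at ht
    linarith [ht.1]
  have hinv : IntervalIntegrable (fun t : ℝ => t⁻¹) volume 1 (1 / c) :=
    (continuousOn_id.inv₀ fun t ht => (hpos t ht).ne').intervalIntegrable
  have hlow : IntervalIntegrable (fun t : ℝ => t⁻¹ - (t ^ 2)⁻¹ - c) volume 1 (1 / c) :=
    (hinv.sub (((continuousOn_id.pow 2).inv₀ fun t ht =>
      (pow_pos (hpos t ht) 2).ne').intervalIntegrable)).sub intervalIntegrable_const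
  have h_lower : -Real.log c - 2 ≤ ∫ t in (1 : ℝ)..(1 / c), f t := by
    have hle : ∫ t in (1 : ℝ)..(1 / c), (t⁻¹ - (t ^ 2)⁻¹ - c) ≤ ∫ t in (1 : ℝ)..(1 / c), f t :=
      intervalIntegral.integral_mono_on hN hlow hfi' fun t ht =>
        le_sqrt_mul_exp_div hc ht.1 ((le_div_iff₀' hc).1 ht.2)
    have hderiv : ∀ t ∈ uIcc 1 (1 / c),
        HasDerivAt (fun t => Real.log t + t⁻¹ - c * t) (t⁻¹ - (t ^ 2)⁻¹ - c) t := fun t ht => by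
      have h0 := (hpos t ht).ne'
      exact (((Real.hasDerivAt_log h0).add (hasDerivAt_inv h0)).sub
        ((hasDerivAt_id t).const_mul c)).congr_deriv (by ring)
    rw [intervalIntegral.integral_eq_sub_of_hasDerivAt hderiv hlow] at hle
    have hcc : c * c⁻¹ = 1 := mul_inv_cancel₀ hc.ne'
    simp only [one_div, Real.log_inv, inv_inv, Real.log_one, inv_one, hcc] at hle ⊢
    linarith
  have h_upper : ∫ t in (1 : ℝ)..(1 / c), f t ≤ -Real.log c := by
    have hle : ∫ t in (1 : ℝ)..(1 / c), f t ≤ ∫ t in (1 : ℝ)..(1 / c), t⁻¹ :=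
      intervalIntegral.integral_mono_on hN hfi' hinv fun t ht => by
        have ht0 : 0 < t := by linarith [ht.1]
        refine (sqrt_mul_exp_div_le hc ht0).trans ?_
        rw [← one_div]
        gcongr
        exact Real.exp_le_one_iff.2 (div_nonpos_of_nonpos_of_nonneg (by norm_num) ht0.le)
    rwa [integral_inv_of_pos one_pos (by positivity), div_one, one_div, Real.log_inv,
      ← one_div] at hle
  have h_nonneg : 0 ≤ ∫ t in (0 : ℝ)..1, f t := by
    rw [intervalIntegral.integral_of_le zero_le_one]
    exact setIntegral_nonneg measurableSet_Ioc fun t ht => sqrt_mul_exp_div_nonneg c ht.1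
  have h_le_one : ∫ t in (0 : ℝ)..1, f t ≤ 1 := by
    have := intervalIntegral.integral_mono_on_of_le_Ioo zero_le_one hfi
      (intervalIntegrable_const (c := (1 : ℝ))) fun t ht =>
        (sqrt_mul_exp_div_le hc ht.1).trans (exp_neg_one_div_div_le_one ht.1)
    simpa using this
  rw [hsplit]
  constructor <;> linarith

/-- **Asymptotics in the proof of Proposition 2.4**: as `u → 0⁺`,
`∫₀^{1/u²} (√(1 - u² t) / t) e^{-1/t} dt ∼ -2 log u`. -/
theorem integral_sqrt_exp_asymptotic :
    Filter.Tendsto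
      (fun u : ℝ =>
        (∫ t in Set.Ioo (0 : ℝ) (1 / u ^ 2),
            Real.sqrt (1 - u ^ 2 * t) * Real.exp (-1 / t) / t) /
          (-2 * Real.log u))
      (nhdsWithin 0 (Set.Ioi 0)) (nhds 1) := by
  have hL : Tendsto (fun u : ℝ => -2 * Real.log u) (nhdsWithin 0 (Ioi 0)) atTop :=
    Real.tendsto_log_nhdsGT_zero.const_mul_atBot_of_neg (by norm_num)
  have hlim (a : ℝ) :
      Tendsto (fun u : ℝ => 1 + a / (-2 * Real.log u)) (nhdsWithin 0 (Ioi 0)) (nhds 1) := by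
    simpa using (hL.const_div_atTop a).const_add 1
  have hbounds : ∀ᶠ u : ℝ in nhdsWithin 0 (Ioi 0), 0 < u ∧ u < 1 := Ioo_mem_nhdsGT one_pos
  refine tendsto_of_tendsto_of_tendsto_of_le_of_le' (hlim (-2)) (hlim 1) ?_ ?_ <;>
  · filter_upwards [hL.eventually_gt_atTop 0, hbounds] with u hLu ⟨hu, hu1⟩
    have h := integral_sqrt_mul_exp_div_bounds (pow_pos hu 2) (pow_lt_one₀ hu.le hu1 two_ne_zero)
    rw [Real.log_pow, Nat.cast_ofNat] at h
    rw [one_add_div hLu.ne']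
    gcongr
    linarith [h.1, h.2]
end
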